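/- arXiv:2404.18070 — 4 statements merged into one kernel-verified Lean document; each statement's English description precedes it below -/
import Mathlib

section
/- Let n ≥ 3 be an integer, set α = 1 − 1/n, and let β ≤ 0 with Q := α − β − 1 satisfying Q ≤ 1. There exists a constant C > 1, depending only on n, such that for all y ≤ −1: C^{-1} · (−y)^{−β} ≤ Φ♯(β, α, y) ≤ C · (−y)^{−β}. -/
/-- The modified Bessel function of the first kind,
`I_ν(y) = (1/π)∫_0^π e^{y·cos θ}·cos(νθ) dθ − (sin(νπ)/π)∫_0^∞ e^{-y·cosh t − νt} dt`. -/
noncomputable def besselI (ν y : ℝ) : ℝ :=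
  (1 / Real.pi) * ∫ θ in (0:ℝ)..Real.pi, Real.exp (y * Real.cos θ) * Real.cos (ν * θ)
    - (Real.sin (ν * Real.pi) / Real.pi) *
      ∫ t in Set.Ioi (0:ℝ), Real.exp (-y * Real.cosh t - ν * t)

/-- `Φ♯(β, α, y) = (Γ(α)/Γ(α−β)) · e^y · (−y)^{β−α} · ∫_0^∞ e^{s/y} · s^{(α−1)/2−β} · I_{α−1}(2√s) ds`. -/
noncomputable def PhiSharp (β α y : ℝ) : ℝ :=
  (Real.Gamma α / Real.Gamma (α - β)) * Real.exp y * (-y) ^ (β - α) *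
    ∫ s in Set.Ioi (0:ℝ),
      Real.exp (s / y) * s ^ ((α - 1) / 2 - β) * besselI (α - 1) (2 * Real.sqrt s)

open MeasureTheory Set

lemma exp_neg_mul_cosh_add_le {μ x t : ℝ} (hμ : μ ≤ 1 / 3) (hx : 0 < x) (ht : 0 ≤ t) :
    Real.exp (-x * Real.cosh t + μ * t) ≤ 2 / √x * Real.exp (-(1 / 6) * t) := by
  have hcosh : Real.exp (t / 2) ^ 2 ≤ 4 * Real.cosh t := by
    rw [← Real.exp_nat_mul, Real.cosh_eq]
    have h1 : ((2 : ℕ) : ℝ) * (t / 2) = t := by push_cast; ring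
    rw [h1]
    nlinarith [Real.exp_pos t, Real.exp_pos (-t)]
  have hsx : 0 < √x := Real.sqrt_pos.2 hx
  have hz : √x * Real.exp (t / 2) / 2 ≤ √(x * Real.cosh t) := by
    apply Real.le_sqrt_of_sq_le
    have : (√x * Real.exp (t / 2) / 2) ^ 2 = x * (Real.exp (t / 2) ^ 2 / 4) := by
      rw [div_pow, mul_pow, Real.sq_sqrt hx.le]; ring
    rw [this]
    exact mul_le_mul_of_nonneg_left (by linarith) hx.le
  have hsqrt : √(x * Real.cosh t) ≤ Real.exp (x * Real.cosh t) := by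
    have hpos : 0 ≤ x * Real.cosh t := by positivity
    nlinarith [Real.add_one_le_exp (x * Real.cosh t), Real.sq_sqrt hpos,
      sq_nonneg (√(x * Real.cosh t) - 1)]
  have hexp : Real.exp (-x * Real.cosh t) ≤ 2 / √x * Real.exp (-(t / 2)) := by
    rw [neg_mul, Real.exp_neg, Real.exp_neg]
    calc (Real.exp (x * Real.cosh t))⁻¹ ≤ (√x * Real.exp (t / 2) / 2)⁻¹ :=
          inv_anti₀ (by positivity) (hz.trans hsqrt)
      _ = _ := by field_simp
  calc Real.exp (-x * Real.cosh t + μ * t)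
      = Real.exp (-x * Real.cosh t) * Real.exp (μ * t) := Real.exp_add _ _
    _ ≤ 2 / √x * Real.exp (-(t / 2)) * Real.exp (μ * t) := by gcongr
    _ = 2 / √x * Real.exp (-(t / 2) + μ * t) := by rw [Real.exp_add]; ring
    _ ≤ _ := by gcongr; nlinarith

lemma integral_exp_neg_mul_cosh_add_le {μ x : ℝ} (hμ : μ ≤ 1 / 3) (hx : 0 < x) :
    ∫ t in Ioi (0 : ℝ), Real.exp (-x * Real.cosh t + μ * t) ≤ 12 / √x := by
  calc ∫ t in Ioi (0 : ℝ), Real.exp (-x * Real.cosh t + μ * t)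
      ≤ ∫ t in Ioi (0 : ℝ), 2 / √x * Real.exp (-(1 / 6) * t) := by
        refine integral_mono_of_nonneg (ae_of_all _ fun t => (Real.exp_pos _).le) ?_ ?_
        · exact (exp_neg_integrableOn_Ioi 0 (by norm_num)).const_mul _
        · filter_upwards [ae_restrict_mem measurableSet_Ioi] with t ht
          exact exp_neg_mul_cosh_add_le hμ hx (le_of_lt ht)
    _ = 12 / √x := by
        rw [integral_const_mul, integral_exp_mul_Ioi (by norm_num)]
        simp
        ring

lemma half_le_cos_mul {μ θ : ℝ} (hμ₀ : 0 ≤ μ) (hμ : μ ≤ 1 / 3) (hθ₀ : 0 ≤ θ)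
    (hθ : θ ≤ Real.pi) : 1 / 2 ≤ Real.cos (μ * θ) := by
  rw [← Real.cos_pi_div_three]
  apply Real.cos_le_cos_of_nonneg_of_le_pi (by positivity) (by linarith [Real.pi_pos])
  nlinarith [Real.pi_pos]

/-- The first integral in `besselI` extends over the whole remaining expression, whose second part
is constant in `θ`; this lemma separates the two parts. -/
lemma besselI_eq (ν y : ℝ) :
    besselI ν y =
      (1 / Real.pi) * (∫ θ in (0:ℝ)..Real.pi, Real.exp (y * Real.cos θ) * Real.cos (ν * θ))
        - (Real.sin (ν * Real.pi) / Real.pi) *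
          ∫ t in Ioi (0:ℝ), Real.exp (-y * Real.cosh t - ν * t) := by
  have hint : IntervalIntegrable (fun θ : ℝ => Real.exp (y * Real.cos θ) * Real.cos (ν * θ))
      volume 0 Real.pi := Continuous.intervalIntegrable (by fun_prop) _ _
  rw [besselI, intervalIntegral.integral_sub hint intervalIntegrable_const,
    intervalIntegral.integral_const, sub_zero, smul_eq_mul, mul_sub]
  congr 1
  field_simp

lemma besselI_neg_eq (μ x : ℝ) :
    besselI (-μ) x =
      (1 / Real.pi) * (∫ θ in (0:ℝ)..Real.pi, Real.exp (x * Real.cos θ) * Real.cos (μ * θ))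
        + (Real.sin (μ * Real.pi) / Real.pi) *
          ∫ t in Ioi (0:ℝ), Real.exp (-x * Real.cosh t + μ * t) := by
  simp only [besselI_eq, neg_mul, Real.cos_neg, Real.sin_neg, sub_neg_eq_add]
  ring

lemma integral_exp_mul_cos_le {μ x : ℝ} (hx : 0 < x) :
    ∫ θ in (0:ℝ)..Real.pi, Real.exp (x * Real.cos θ) * Real.cos (μ * θ)
      ≤ Real.pi * Real.exp x / √x := by
  have hπ := Real.pi_pos
  have hb : 0 < 2 * x / Real.pi ^ 2 := by positivity
  have hsx : 0 < √x := Real.sqrt_pos.2 hx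
  have hint : Integrable fun θ : ℝ => Real.exp x * Real.exp (-(2 * x / Real.pi ^ 2) * θ ^ 2) :=
    (integrable_exp_neg_mul_sq hb).const_mul _
  calc ∫ θ in (0:ℝ)..Real.pi, Real.exp (x * Real.cos θ) * Real.cos (μ * θ)
      ≤ ∫ θ in (0:ℝ)..Real.pi, Real.exp x * Real.exp (-(2 * x / Real.pi ^ 2) * θ ^ 2) := by
        apply intervalIntegral.integral_mono_on hπ.le
        · exact Continuous.intervalIntegrable (by fun_prop) _ _
        · exact hint.intervalIntegrable
        · intro θ hθ
          rw [← Real.exp_add]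
          have hcos := Real.cos_le_one_sub_mul_cos_sq
            (abs_le.2 ⟨by linarith [hθ.1], hθ.2⟩ : |θ| ≤ Real.pi)
          calc Real.exp (x * Real.cos θ) * Real.cos (μ * θ)
              ≤ Real.exp (x * Real.cos θ) * 1 := by gcongr; exact Real.cos_le_one _
            _ ≤ _ := by
              rw [mul_one]
              gcongr
              calc x * Real.cos θ ≤ x * (1 - 2 / Real.pi ^ 2 * θ ^ 2) := by gcongr
                _ = _ := by ring
    _ ≤ ∫ θ in Ioi (0 : ℝ), Real.exp x * Real.exp (-(2 * x / Real.pi ^ 2) * θ ^ 2) := by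
        rw [intervalIntegral.integral_of_le hπ.le]
        apply setIntegral_mono_set hint.integrableOn
        · exact ae_of_all _ fun θ => by positivity
        · exact (Ioc_subset_Ioi_self).eventuallyLE
    _ = Real.exp x * (√(Real.pi / (2 * x / Real.pi ^ 2)) / 2) := by
        rw [integral_const_mul, integral_gaussian_Ioi]
    _ ≤ Real.exp x * (Real.pi / √x) := by
        refine mul_le_mul_of_nonneg_left ?_ (Real.exp_pos x).le
        have : √(Real.pi / (2 * x / Real.pi ^ 2)) ≤ 2 * (Real.pi / √x) := by
          apply Real.sqrt_le_iff.2 ⟨by positivity, ?_⟩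
          rw [mul_pow, div_pow, Real.sq_sqrt hx.le]
          field_simp
          nlinarith [Real.pi_le_four]
        linarith
    _ = _ := by ring

lemma le_integral_exp_mul_cos {μ x : ℝ} (hμ₀ : 0 ≤ μ) (hμ : μ ≤ 1 / 3) (hx : 1 ≤ x) :
    Real.exp x / (4 * √x) ≤
      ∫ θ in (0:ℝ)..Real.pi, Real.exp (x * Real.cos θ) * Real.cos (μ * θ) := by
  have hsx : 1 ≤ √x := Real.one_le_sqrt.2 hx
  have hle : 1 / √x ≤ Real.pi := by
    have : 1 / √x ≤ 1 := (div_le_one (by positivity)).2 hsx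
    linarith [Real.pi_gt_three]
  have h0 : 0 ≤ 1 / √x := by positivity
  calc Real.exp x / (4 * √x) = ∫ _ in (0:ℝ)..(1 / √x), Real.exp x / 4 := by
        rw [intervalIntegral.integral_const, smul_eq_mul]; field_simp; ring
    _ ≤ ∫ θ in (0:ℝ)..(1 / √x), Real.exp (x * Real.cos θ) * Real.cos (μ * θ) := by
        apply intervalIntegral.integral_mono_on h0 intervalIntegrable_const
        · exact Continuous.intervalIntegrable (by fun_prop) _ _
        · intro θ hθ
          have hsq : x * θ ^ 2 ≤ 1 := by
            have h1 : θ ^ 2 ≤ (1 / √x) ^ 2 := pow_le_pow_left₀ hθ.1 hθ.2 2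
            rw [div_pow, Real.sq_sqrt (by linarith), one_pow] at h1
            calc x * θ ^ 2 ≤ x * (1 / x) := by gcongr
              _ = 1 := by field_simp
          have h2 : x - 1 / 2 ≤ x * Real.cos θ := by
            nlinarith [Real.one_sub_sq_div_two_le_cos (x := θ)]
          have h3 : Real.exp x / 2 ≤ Real.exp (x * Real.cos θ) := by
            calc Real.exp x / 2 = Real.exp x * (-(1 / 2) + 1) := by ring
              _ ≤ Real.exp x * Real.exp (-(1 / 2)) := by gcongr; exact Real.add_one_le_exp _
              _ = Real.exp (x - 1 / 2) := by rw [← Real.exp_add]; ring_nf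
              _ ≤ _ := Real.exp_le_exp.2 h2
          have h4 := half_le_cos_mul hμ₀ hμ hθ.1 (hθ.2.trans hle)
          calc Real.exp x / 4 = Real.exp x / 2 * (1 / 2) := by ring
            _ ≤ _ := by gcongr
    _ ≤ _ := by
        apply intervalIntegral.integral_mono_interval le_rfl h0 hle
        · filter_upwards [ae_restrict_mem measurableSet_Ioc] with θ hθ
          have := half_le_cos_mul hμ₀ hμ hθ.1.le hθ.2
          exact mul_nonneg (Real.exp_pos _).le (by linarith)
        · exact Continuous.intervalIntegrable (by fun_prop) _ _

lemma sin_mul_pi_div_pi_nonneg {μ : ℝ} (hμ₀ : 0 ≤ μ) (hμ : μ ≤ 1 / 3) :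
    0 ≤ Real.sin (μ * Real.pi) / Real.pi :=
  div_nonneg (Real.sin_nonneg_of_nonneg_of_le_pi (mul_nonneg hμ₀ Real.pi_pos.le)
    (by nlinarith [Real.pi_pos])) Real.pi_pos.le

lemma besselI_neg_nonneg {μ : ℝ} (hμ₀ : 0 ≤ μ) (hμ : μ ≤ 1 / 3) (x : ℝ) :
    0 ≤ besselI (-μ) x := by
  rw [besselI_neg_eq]
  have h1 : 0 ≤ ∫ θ in (0:ℝ)..Real.pi, Real.exp (x * Real.cos θ) * Real.cos (μ * θ) := by
    apply intervalIntegral.integral_nonneg Real.pi_pos.le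
    intro θ hθ
    have := half_le_cos_mul hμ₀ hμ hθ.1 hθ.2
    exact mul_nonneg (Real.exp_pos _).le (by linarith)
  have h2 : 0 ≤ ∫ t in Ioi (0:ℝ), Real.exp (-x * Real.cosh t + μ * t) :=
    integral_nonneg fun t => (Real.exp_pos _).le
  have h3 := sin_mul_pi_div_pi_nonneg hμ₀ hμ
  positivity

lemma besselI_neg_le {μ x : ℝ} (hμ : μ ≤ 1 / 3) (hx : 0 < x) :
    besselI (-μ) x ≤ 13 * Real.exp x / √x := by
  rw [besselI_neg_eq]
  have hπ := Real.pi_pos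
  have hsx : 0 < √x := Real.sqrt_pos.2 hx
  have h1 : (1 / Real.pi) *
      (∫ θ in (0:ℝ)..Real.pi, Real.exp (x * Real.cos θ) * Real.cos (μ * θ)) ≤
        Real.exp x / √x := by
    calc _ ≤ (1 / Real.pi) * (Real.pi * Real.exp x / √x) := by
          gcongr; exact integral_exp_mul_cos_le hx
      _ = _ := by field_simp
  have h2 : Real.sin (μ * Real.pi) / Real.pi ≤ 1 := by
    rw [div_le_one hπ]
    linarith [Real.sin_le_one (μ * Real.pi), Real.pi_gt_three]
  have h3 : (Real.sin (μ * Real.pi) / Real.pi) *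
      (∫ t in Ioi (0:ℝ), Real.exp (-x * Real.cosh t + μ * t)) ≤ 12 * Real.exp x / √x := by
    calc _ ≤ 1 * (12 / √x) :=
          mul_le_mul h2 (integral_exp_neg_mul_cosh_add_le hμ hx)
            (integral_nonneg fun t => (Real.exp_pos _).le) zero_le_one
      _ ≤ _ := by
          rw [one_mul]
          gcongr
          linarith [Real.one_le_exp hx.le]
  calc _ ≤ Real.exp x / √x + 12 * Real.exp x / √x := add_le_add h1 h3
    _ = _ := by ring

lemma le_besselI_neg {μ x : ℝ} (hμ₀ : 0 ≤ μ) (hμ : μ ≤ 1 / 3) (hx : 1 ≤ x) :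
    Real.exp x / (16 * √x) ≤ besselI (-μ) x := by
  rw [besselI_neg_eq]
  have hπ := Real.pi_pos
  have hsx : 1 ≤ √x := Real.one_le_sqrt.2 hx
  have h1 : 0 ≤ (Real.sin (μ * Real.pi) / Real.pi) *
      ∫ t in Ioi (0:ℝ), Real.exp (-x * Real.cosh t + μ * t) :=
    mul_nonneg (sin_mul_pi_div_pi_nonneg hμ₀ hμ) (integral_nonneg fun t => (Real.exp_pos _).le)
  have h2 : 1 / 4 ≤ 1 / Real.pi := one_div_le_one_div_of_le hπ Real.pi_le_four
  calc Real.exp x / (16 * √x) = 1 / 4 * (Real.exp x / (4 * √x)) := by field_simp; ring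
    _ ≤ (1 / Real.pi) *
        (∫ θ in (0:ℝ)..Real.pi, Real.exp (x * Real.cos θ) * Real.cos (μ * θ)) := by
      gcongr
      exact le_integral_exp_mul_cos hμ₀ hμ hx
    _ ≤ _ := by linarith

lemma measurable_besselI (ν : ℝ) : Measurable (besselI ν) := by
  rw [funext (besselI_eq ν)]
  have h1 : StronglyMeasurable fun y : ℝ =>
      ∫ θ in Ioc (0:ℝ) Real.pi, Real.exp (y * Real.cos θ) * Real.cos (ν * θ) := by
    apply StronglyMeasurable.integral_prod_right'
      (f := fun p : ℝ × ℝ => Real.exp (p.1 * Real.cos p.2) * Real.cos (ν * p.2))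
    exact Continuous.stronglyMeasurable (by fun_prop)
  have h2 : StronglyMeasurable fun y : ℝ =>
      ∫ t in Ioi (0:ℝ), Real.exp (-y * Real.cosh t - ν * t) := by
    apply StronglyMeasurable.integral_prod_right'
      (f := fun p : ℝ × ℝ => Real.exp (-p.1 * Real.cosh p.2 - ν * p.2))
    exact Continuous.stronglyMeasurable (by fun_prop)
  simp only [intervalIntegral.integral_of_le Real.pi_pos.le]
  exact (h1.measurable.const_mul _).sub (h2.measurable.const_mul _)

lemma rpow_le_mul_exp_sq {p u Y : ℝ} (hp₀ : 0 ≤ p) (hp : p ≤ 3) (hu : 0 < u) (hY : 1 ≤ Y) :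
    u ^ p ≤ 8 * Y ^ p * Real.exp ((u - Y) ^ 2 / (2 * Y)) := by
  have hsY : 1 ≤ √Y := Real.one_le_sqrt.2 hY
  have hYsq : √Y * √Y = Y := Real.mul_self_sqrt (by linarith)
  set v := |u - Y| / √Y with hv
  have hv0 : 0 ≤ v := by positivity
  have huv : u ≤ Y * (1 + v) := by
    have h1 : Y * v = √Y * |u - Y| := by
      rw [hv]; nth_rewrite 1 [← hYsq]; field_simp
    nlinarith [le_abs_self (u - Y), abs_nonneg (u - Y)]
  have hvsq : v ^ 2 / 2 = (u - Y) ^ 2 / (2 * Y) := by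
    rw [hv, div_pow, sq_abs, Real.sq_sqrt (by linarith)]; field_simp
  have hlin : 1 + v ≤ 2 * Real.exp (v ^ 2 / 6) := by
    nlinarith [Real.add_one_le_exp (v ^ 2 / 6), sq_nonneg (v - 3 / 2)]
  have hcube : (1 + v) ^ 3 ≤ 8 * Real.exp ((u - Y) ^ 2 / (2 * Y)) := by
    calc (1 + v) ^ 3 ≤ (2 * Real.exp (v ^ 2 / 6)) ^ 3 := by gcongr
      _ = 8 * Real.exp ((u - Y) ^ 2 / (2 * Y)) := by
        rw [mul_pow, ← Real.exp_nat_mul, ← hvsq]; norm_num; ring_nf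
  calc u ^ p ≤ (Y * (1 + v)) ^ p := Real.rpow_le_rpow hu.le huv hp₀
    _ = Y ^ p * (1 + v) ^ p := Real.mul_rpow (by linarith) (by linarith)
    _ ≤ Y ^ p * (1 + v) ^ (3 : ℝ) := by
        gcongr
        linarith
    _ = Y ^ p * (1 + v) ^ 3 := by norm_cast
    _ ≤ Y ^ p * (8 * Real.exp ((u - Y) ^ 2 / (2 * Y))) := by gcongr
    _ = _ := by ring

/-- The integrand of `PhiSharp` after the substitution `s = u ^ 2`. -/
noncomputable def besselIntegrand (μ q Y u : ℝ) : ℝ :=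
  2 * u * (Real.exp (-u ^ 2 / Y) * (u ^ 2) ^ q * besselI (-μ) (2 * u))

lemma integral_eq_integral_besselIntegrand (μ q Y : ℝ) :
    ∫ s in Ioi (0:ℝ), Real.exp (s / (-Y)) * s ^ q * besselI (-μ) (2 * √s) =
      ∫ u in Ioi (0:ℝ), besselIntegrand μ q Y u := by
  rw [← integral_comp_rpow_Ioi_of_pos (p := 2) (by norm_num)]
  apply setIntegral_congr_fun measurableSet_Ioi
  intro u hu
  have hu : 0 < u := hu
  have h1 : u ^ ((2 : ℝ) - 1) = u := by norm_num
  simp only [besselIntegrand, smul_eq_mul, h1, Real.rpow_two, Real.sqrt_sq hu.le, div_neg, neg_div]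

lemma measurable_besselIntegrand (μ q Y : ℝ) : Measurable (besselIntegrand μ q Y) := by
  unfold besselIntegrand
  have h : Measurable fun u : ℝ => besselI (-μ) (2 * u) :=
    (measurable_besselI _).comp (measurable_const_mul 2)
  fun_prop

lemma besselIntegrand_nonneg {μ u : ℝ} (hμ₀ : 0 ≤ μ) (hμ : μ ≤ 1 / 3) (q Y : ℝ) (hu : 0 ≤ u) :
    0 ≤ besselIntegrand μ q Y u := by
  have := besselI_neg_nonneg hμ₀ hμ (2 * u)
  unfold besselIntegrand
  positivity

lemma mul_sq_rpow_div_sqrt {u : ℝ} (hu : 0 < u) (q : ℝ) :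
    u * (u ^ 2) ^ q / √u = u ^ (2 * q + 1 / 2) := by
  rw [Real.sqrt_eq_rpow, ← Real.rpow_two, ← Real.rpow_mul hu.le]
  nth_rewrite 1 [← Real.rpow_one u]
  rw [← Real.rpow_add hu, ← Real.rpow_sub hu]
  ring_nf

lemma exp_neg_sq_div_mul_exp {Y : ℝ} (hY : 0 < Y) (u : ℝ) :
    Real.exp (-u ^ 2 / Y) * Real.exp (2 * u) =
      Real.exp Y * Real.exp (-((u - Y) ^ 2 / Y)) := by
  rw [← Real.exp_add, ← Real.exp_add]
  congr 1
  field_simp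
  ring

lemma besselIntegrand_le {μ q Y u : ℝ} (hμ : μ ≤ 1 / 3) (hq₀ : -(1 / 4) ≤ q)
    (hq : q ≤ 5 / 4) (hY : 1 ≤ Y) (hu : 0 < u) :
    besselIntegrand μ q Y u ≤
      208 * Real.exp Y * Y ^ (2 * q + 1 / 2) * Real.exp (-(1 / (2 * Y)) * (u - Y) ^ 2) := by
  have hY0 : 0 < Y := by linarith
  have hsu : 0 < √u := Real.sqrt_pos.2 hu
  have hI : besselI (-μ) (2 * u) ≤ 13 * Real.exp (2 * u) / √u := by
    refine (besselI_neg_le hμ (by positivity)).trans ?_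
    gcongr
    linarith
  calc besselIntegrand μ q Y u
      ≤ 2 * u * (Real.exp (-u ^ 2 / Y) * (u ^ 2) ^ q * (13 * Real.exp (2 * u) / √u)) := by
        unfold besselIntegrand; gcongr
    _ = 26 * (u * (u ^ 2) ^ q / √u) * (Real.exp (-u ^ 2 / Y) * Real.exp (2 * u)) := by ring
    _ = 26 * u ^ (2 * q + 1 / 2) * (Real.exp Y * Real.exp (-((u - Y) ^ 2 / Y))) := by
        rw [mul_sq_rpow_div_sqrt hu, exp_neg_sq_div_mul_exp hY0]
    _ ≤ 26 * (8 * Y ^ (2 * q + 1 / 2) * Real.exp ((u - Y) ^ 2 / (2 * Y))) *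
          (Real.exp Y * Real.exp (-((u - Y) ^ 2 / Y))) := by
        gcongr
        exact rpow_le_mul_exp_sq (by linarith) (by linarith) hu hY
    _ = 208 * Real.exp Y * Y ^ (2 * q + 1 / 2) *
          (Real.exp ((u - Y) ^ 2 / (2 * Y)) * Real.exp (-((u - Y) ^ 2 / Y))) := by ring
    _ = _ := by
        rw [← Real.exp_add]
        congr 2
        field_simp
        ring

lemma le_besselIntegrand {μ q Y u : ℝ} (hμ₀ : 0 ≤ μ) (hμ : μ ≤ 1 / 3) (hq₀ : -(1 / 4) ≤ q)
    (hY : 1 ≤ Y) (hYu : Y ≤ u) (huY : u ≤ Y + √Y) :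
    1 / 16 * Real.exp (-1) * Real.exp Y * Y ^ (2 * q + 1 / 2) ≤ besselIntegrand μ q Y u := by
  have hY0 : 0 < Y := by linarith
  have hu : 0 < u := by linarith
  have hsu : 0 < √u := Real.sqrt_pos.2 hu
  have hI : Real.exp (2 * u) / (32 * √u) ≤ besselI (-μ) (2 * u) := by
    refine le_trans ?_ (le_besselI_neg hμ₀ hμ (by linarith))
    have : √(2 * u) ≤ 2 * √u := by
      rw [Real.sqrt_le_iff, mul_pow, Real.sq_sqrt hu.le]
      exact ⟨by positivity, by linarith⟩
    apply div_le_div_of_nonneg_left (Real.exp_pos _).le (by positivity)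
    linarith
  have hsq : (u - Y) ^ 2 / Y ≤ 1 := by
    rw [div_le_one hY0]
    calc (u - Y) ^ 2 ≤ √Y ^ 2 := pow_le_pow_left₀ (by linarith) (by linarith) 2
      _ = Y := Real.sq_sqrt hY0.le
  calc 1 / 16 * Real.exp (-1) * Real.exp Y * Y ^ (2 * q + 1 / 2)
      = 1 / 16 * Y ^ (2 * q + 1 / 2) * (Real.exp Y * Real.exp (-1)) := by ring
    _ ≤ 1 / 16 * u ^ (2 * q + 1 / 2) * (Real.exp Y * Real.exp (-((u - Y) ^ 2 / Y))) := by
        have : 0 ≤ 2 * q + 1 / 2 := by linarith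
        gcongr
    _ = 1 / 16 * (u * (u ^ 2) ^ q / √u) * (Real.exp (-u ^ 2 / Y) * Real.exp (2 * u)) := by
        rw [mul_sq_rpow_div_sqrt hu, exp_neg_sq_div_mul_exp hY0]
    _ = 2 * u * (Real.exp (-u ^ 2 / Y) * (u ^ 2) ^ q * (Real.exp (2 * u) / (32 * √u))) := by
        field_simp; ring
    _ ≤ _ := by unfold besselIntegrand; gcongr

lemma rpow_mul_sqrt_eq {Y : ℝ} (hY : 0 < Y) (q : ℝ) :
    Y ^ (2 * q + 1 / 2) * √Y = Y ^ (2 * q + 1) := by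
  rw [Real.sqrt_eq_rpow, ← Real.rpow_add hY]
  ring_nf

lemma integrable_gaussian_shift {Y : ℝ} (hY : 0 < Y) :
    Integrable fun u : ℝ => Real.exp (-(1 / (2 * Y)) * (u - Y) ^ 2) :=
  (integrable_exp_neg_mul_sq (b := 1 / (2 * Y)) (by positivity)).comp_sub_right Y

lemma integral_besselIntegrand_le {μ q Y : ℝ} (hμ₀ : 0 ≤ μ) (hμ : μ ≤ 1 / 3)
    (hq₀ : -(1 / 4) ≤ q) (hq : q ≤ 5 / 4) (hY : 1 ≤ Y) :
    ∫ u in Ioi (0:ℝ), besselIntegrand μ q Y u ≤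
      208 * √(2 * Real.pi) * (Real.exp Y * Y ^ (2 * q + 1)) := by
  have hY0 : 0 < Y := by linarith
  have hint := integrable_gaussian_shift hY0
  calc ∫ u in Ioi (0:ℝ), besselIntegrand μ q Y u
      ≤ ∫ u in Ioi (0:ℝ), 208 * Real.exp Y * Y ^ (2 * q + 1 / 2) *
          Real.exp (-(1 / (2 * Y)) * (u - Y) ^ 2) := by
        refine integral_mono_of_nonneg ?_ (hint.const_mul _).integrableOn ?_
        · filter_upwards [ae_restrict_mem measurableSet_Ioi] with u hu
          exact besselIntegrand_nonneg hμ₀ hμ q Y (le_of_lt hu)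
        · filter_upwards [ae_restrict_mem measurableSet_Ioi] with u hu
          exact besselIntegrand_le hμ hq₀ hq hY hu
    _ ≤ ∫ u, 208 * Real.exp Y * Y ^ (2 * q + 1 / 2) *
          Real.exp (-(1 / (2 * Y)) * (u - Y) ^ 2) :=
        setIntegral_le_integral (hint.const_mul _) (ae_of_all _ fun u => by positivity)
    _ = 208 * Real.exp Y * Y ^ (2 * q + 1 / 2) * √(Real.pi / (1 / (2 * Y))) := by
        rw [integral_const_mul,
          integral_sub_right_eq_self (fun u => Real.exp (-(1 / (2 * Y)) * u ^ 2)) Y,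
          integral_gaussian]
    _ = _ := by
        have : Real.pi / (1 / (2 * Y)) = 2 * Real.pi * Y := by field_simp
        rw [this, Real.sqrt_mul (by positivity), ← rpow_mul_sqrt_eq hY0]
        ring

lemma le_integral_besselIntegrand {μ q Y : ℝ} (hμ₀ : 0 ≤ μ) (hμ : μ ≤ 1 / 3)
    (hq₀ : -(1 / 4) ≤ q) (hq : q ≤ 5 / 4) (hY : 1 ≤ Y) :
    1 / 16 * Real.exp (-1) * (Real.exp Y * Y ^ (2 * q + 1)) ≤
      ∫ u in Ioi (0:ℝ), besselIntegrand μ q Y u := by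
  have hY0 : 0 < Y := by linarith
  have hsY : 0 ≤ √Y := Real.sqrt_nonneg _
  have hint : IntegrableOn (besselIntegrand μ q Y) (Ioi 0) := by
    refine Integrable.mono' (((integrable_gaussian_shift hY0).const_mul
      (208 * Real.exp Y * Y ^ (2 * q + 1 / 2))).integrableOn)
      (measurable_besselIntegrand μ q Y).aestronglyMeasurable ?_
    filter_upwards [ae_restrict_mem measurableSet_Ioi] with u hu
    rw [Real.norm_of_nonneg (besselIntegrand_nonneg hμ₀ hμ q Y (le_of_lt hu))]
    exact besselIntegrand_le hμ hq₀ hq hY hu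
  have hsub : Icc Y (Y + √Y) ⊆ Ioi 0 := fun u hu => hY0.trans_le hu.1
  calc 1 / 16 * Real.exp (-1) * (Real.exp Y * Y ^ (2 * q + 1))
      = ∫ _ in Icc Y (Y + √Y),
          1 / 16 * Real.exp (-1) * Real.exp Y * Y ^ (2 * q + 1 / 2) := by
        rw [setIntegral_const, Real.volume_real_Icc_of_le (by linarith), smul_eq_mul,
          ← rpow_mul_sqrt_eq hY0]
        ring
    _ ≤ ∫ u in Icc Y (Y + √Y), besselIntegrand μ q Y u :=
        setIntegral_mono_on (integrableOn_const (by simp)) (hint.mono_set hsub) measurableSet_Icc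
          fun u hu => le_besselIntegrand hμ₀ hμ hq₀ hY hu.1 hu.2
    _ ≤ _ := by
        refine setIntegral_mono_set hint ?_ hsub.eventuallyLE
        filter_upwards [ae_restrict_mem measurableSet_Ioi] with u hu
        exact besselIntegrand_nonneg hμ₀ hμ q Y (le_of_lt hu)

lemma exists_Gamma_bounds {a b : ℝ} (ha : 0 < a) (hab : a ≤ b) :
    ∃ m M : ℝ, 0 < m ∧ 0 < M ∧ ∀ x ∈ Icc a b, m ≤ Real.Gamma x ∧ Real.Gamma x ≤ M := by
  have hcont : ContinuousOn Real.Gamma (Icc a b) := by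
    intro x hx
    refine (Real.differentiableAt_Gamma fun m => ?_).continuousAt.continuousWithinAt
    have : (0 : ℝ) ≤ m := m.cast_nonneg
    have := ha.trans_le hx.1
    linarith
  have hne : (Icc a b).Nonempty := nonempty_Icc.2 hab
  obtain ⟨x, hx, hmin⟩ := isCompact_Icc.exists_isMinOn hne hcont
  obtain ⟨z, hz, hmax⟩ := isCompact_Icc.exists_isMaxOn hne hcont
  exact ⟨Real.Gamma x, Real.Gamma z, Real.Gamma_pos_of_pos (ha.trans_le hx.1),
    Real.Gamma_pos_of_pos (ha.trans_le hz.1), fun w hw => ⟨hmin hw, hmax hw⟩⟩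

/-- For an integer `n ≥ 3`, `α = 1 − 1/n`, there is a constant `C > 1` depending only on `n`
such that for every `β ≤ 0` with `Q := α − β − 1 ≤ 1` and every `y ≤ −1`:
`C⁻¹ · (−y)^{−β} ≤ Φ♯(β, α, y) ≤ C · (−y)^{−β}`. -/
theorem PhiSharp_bounds_small_Q (n : ℕ) (hn : 3 ≤ n) :
    ∃ C : ℝ, 1 < C ∧ ∀ β : ℝ, β ≤ 0 →
      (1 - 1 / (n : ℝ)) - β - 1 ≤ 1 → ∀ y : ℝ, y ≤ -1 →
        C⁻¹ * (-y) ^ (-β) ≤ PhiSharp β (1 - 1 / (n : ℝ)) y ∧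
        PhiSharp β (1 - 1 / (n : ℝ)) y ≤ C * (-y) ^ (-β) := by
  have hn' : (3 : ℝ) ≤ n := by exact_mod_cast hn
  have hμ₀ : 0 ≤ 1 / (n : ℝ) := by positivity
  have hμ : 1 / (n : ℝ) ≤ 1 / 3 := one_div_le_one_div_of_le (by norm_num) hn'
  set μ : ℝ := 1 / (n : ℝ)
  obtain ⟨m, M, hm, hM, hGamma⟩ :=
    exists_Gamma_bounds (a := 1 - μ) (b := 2) (by linarith) (by linarith)
  have hG : 0 < Real.Gamma (1 - μ) := Real.Gamma_pos_of_pos (by linarith)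
  set A := Real.Gamma (1 - μ) / m * (208 * √(2 * Real.pi)) with hA
  set B := Real.Gamma (1 - μ) / M * (1 / 16 * Real.exp (-1)) with hB
  have hB0 : 0 < B := by positivity
  refine ⟨max 2 (max A B⁻¹), lt_max_of_lt_left one_lt_two, fun β hβ hQ y hy => ?_⟩
  obtain ⟨Y, rfl⟩ : ∃ Y, y = -Y := ⟨-y, (neg_neg y).symm⟩
  have hY : 1 ≤ Y := by linarith
  have hY0 : 0 < Y := by linarith
  have hα : 1 - μ - 1 = -μ := by ring
  have hq₀ : -(1 / 4) ≤ -μ / 2 - β := by linarith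
  have hq : -μ / 2 - β ≤ 5 / 4 := by linarith
  have hup := integral_besselIntegrand_le hμ₀ hμ hq₀ hq hY
  have hlow := le_integral_besselIntegrand hμ₀ hμ hq₀ hq hY
  obtain ⟨hg, hg'⟩ := hGamma (1 - μ - β) ⟨by linarith, by linarith⟩
  have hg0 : 0 < Real.Gamma (1 - μ - β) := hm.trans_le hg
  have hPhi : PhiSharp β (1 - μ) (-Y) =
      Real.Gamma (1 - μ) / Real.Gamma (1 - μ - β) * Real.exp (-Y) * Y ^ (β - (1 - μ)) *
        ∫ u in Ioi (0:ℝ), besselIntegrand μ (-μ / 2 - β) Y u := by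
    rw [PhiSharp, hα, integral_eq_integral_besselIntegrand, neg_neg]
  have hpow (c k : ℝ) : c * Real.exp (-Y) * Y ^ (β - (1 - μ)) *
      (k * (Real.exp Y * Y ^ (2 * (-μ / 2 - β) + 1))) = c * k * Y ^ (-β) := by
    have h1 : Y ^ (-β) = Y ^ (β - (1 - μ)) * Y ^ (2 * (-μ / 2 - β) + 1) := by
      rw [← Real.rpow_add hY0]; ring_nf
    have h2 : Real.exp (-Y) * Real.exp Y = 1 := by rw [← Real.exp_add]; simp
    calc _ = c * k * (Real.exp (-Y) * Real.exp Y) *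
          (Y ^ (β - (1 - μ)) * Y ^ (2 * (-μ / 2 - β) + 1)) := by ring
      _ = _ := by rw [h2, h1, mul_one]
  rw [hPhi, neg_neg]
  constructor
  · calc (max 2 (max A B⁻¹))⁻¹ * Y ^ (-β) ≤ B * Y ^ (-β) := by
          gcongr
          exact inv_le_of_inv_le₀ hB0 ((le_max_right _ _).trans (le_max_right _ _))
      _ ≤ Real.Gamma (1 - μ) / Real.Gamma (1 - μ - β) * (1 / 16 * Real.exp (-1)) * Y ^ (-β) := by
          rw [hB]; gcongr
      _ = _ := (hpow _ _).symm
      _ ≤ _ := by gcongr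
  · calc _ ≤ _ := mul_le_mul_of_nonneg_left hup (by positivity)
      _ = Real.Gamma (1 - μ) / Real.Gamma (1 - μ - β) * (208 * √(2 * Real.pi)) * Y ^ (-β) :=
          hpow _ _
      _ ≤ A * Y ^ (-β) := by rw [hA]; gcongr
      _ ≤ _ := by
          gcongr
          exact (le_max_left _ _).trans (le_max_right _ _)
end

section
/- Let n ≥ 3 be an integer, set α = 1 − 1/n, and let β ≤ 0 with Q := α − β − 1 satisfying Q ≥ 1. There exists a constant C > 1, depending only on n, such that for all y ≤ −1: C^{-1} · Q^{−1/4 − 1/(2n)} · (−y)^{−1} · e^{y + F(t₀)} / Γ(Q+1) ≤ Ψ♭(β, α, y) ≤ C · Q^{1/4} · e^{y + F(t₀)} / Γ(Q+1), where F(t) = y·t + Q·log(t/(t+1)) and t₀ = (1/2)·(−1 + √(1 + 4Q/(−y))). -/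
/-- `Ψ♭(β, α, y) = (e^y/Γ(α−β)) · ∫_0^∞ e^{y·s} · s^{α−β−1} · (1+s)^{β−1} ds`. -/
noncomputable def PsiFlat (β α y : ℝ) : ℝ :=
  (Real.exp y / Real.Gamma (α - β)) *
    ∫ s in Set.Ioi (0:ℝ), Real.exp (y * s) * s ^ (α - β - 1) * (1 + s) ^ (β - 1)

open MeasureTheory Set

/-- The phase `F(t) = y·t + Q·log(t/(t+1))` of the integral defining `PsiFlat`. -/
noncomputable def psiPhase (Q y t : ℝ) : ℝ := y * t + Q * Real.log (t / (t + 1))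

lemma psiPhase_le {Q x T t : ℝ} (hx : 0 ≤ x) (hT : 0 < T) (hQ : Q = x * (T * (T + 1)))
    (ht : 0 < t) : psiPhase Q (-x) t ≤ psiPhase Q (-x) T := by
  have hlog : Real.log (t / (t + 1)) - Real.log (T / (T + 1)) ≤ (t - T) / (T * (t + 1)) := by
    rw [← Real.log_div (by positivity) (by positivity)]
    refine (Real.log_le_sub_one_of_pos (by positivity)).trans_eq ?_
    field_simp
    ring
  have hQ0 : 0 ≤ Q := by rw [hQ]; positivity
  have hmul := mul_le_mul_of_nonneg_left hlog hQ0
  have hid : Q * ((t - T) / (T * (t + 1))) - x * (t - T) = -(x * (t - T) ^ 2 / (t + 1)) := by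
    rw [hQ]
    field_simp
    ring
  have hnonneg : 0 ≤ x * (t - T) ^ 2 / (t + 1) := by positivity
  unfold psiPhase
  linarith

lemma psiPhase_sub_le {Q x T t : ℝ} (hx : 0 ≤ x) (hT : 0 < T) (hQ : Q = x * (T * (T + 1)))
    (ht : T ≤ t) : psiPhase Q (-x) T - x * (t - T) ^ 2 / T ≤ psiPhase Q (-x) t := by
  have ht0 : 0 < t := hT.trans_le ht
  have hlog : (t - T) / (t * (T + 1)) ≤ Real.log (t / (t + 1)) - Real.log (T / (T + 1)) := by
    rw [← Real.log_div (by positivity) (by positivity)]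
    refine Eq.trans_le ?_ (Real.one_sub_inv_le_log_of_pos (by positivity))
    field_simp
    ring
  have hQ0 : 0 ≤ Q := by rw [hQ]; positivity
  have hmul := mul_le_mul_of_nonneg_left hlog hQ0
  have hid : x * (t - T) - Q * ((t - T) / (t * (T + 1))) = x * (t - T) ^ 2 / t := by
    rw [hQ]
    field_simp
  have hle : x * (t - T) ^ 2 / t ≤ x * (t - T) ^ 2 / T := by gcongr
  unfold psiPhase
  linarith

lemma exp_mul_rpow_mul_rpow_eq {Q y r s : ℝ} (hs : 0 < s) :
    Real.exp (y * s) * s ^ Q * (1 + s) ^ (r - Q)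
      = Real.exp (psiPhase Q y s) * (1 + s) ^ r := by
  rw [psiPhase, Real.exp_add, Real.log_div hs.ne' (by positivity), mul_sub, Real.exp_sub,
    Real.rpow_sub (by positivity), Real.rpow_def_of_pos hs,
    Real.rpow_def_of_pos (by positivity : 0 < 1 + s) Q, mul_comm Q, mul_comm Q, add_comm s 1]
  ring

lemma integrableOn_one_add_rpow {r : ℝ} (hr : r < -1) :
    IntegrableOn (fun s : ℝ => (1 + s) ^ r) (Ioi 0) := by
  simpa only [add_comm] using integrableOn_add_rpow_Ioi_of_lt (m := 1) (c := 0) hr (by norm_num)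

section

variable {Q x T r : ℝ}

lemma integrableOn_exp_psiPhase (hx : 0 ≤ x) (hT : 0 < T)
    (hQ : Q = x * (T * (T + 1))) (hr : r < -1) :
    IntegrableOn (fun s : ℝ => Real.exp (psiPhase Q (-x) s) * (1 + s) ^ r) (Ioi 0) := by
  refine Integrable.mono' ((integrableOn_one_add_rpow hr).const_mul
    (Real.exp (psiPhase Q (-x) T))) ?_ ?_
  · unfold psiPhase
    exact Measurable.aestronglyMeasurable (by fun_prop)
  · filter_upwards [ae_restrict_mem measurableSet_Ioi] with s hs
    have hs : 0 < s := hs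
    rw [Real.norm_of_nonneg (by positivity)]
    gcongr
    exact psiPhase_le hx hT hQ hs

lemma integral_exp_psiPhase_le (hx : 0 ≤ x) (hT : 0 < T)
    (hQ : Q = x * (T * (T + 1))) (hr : r < -1) :
    ∫ s in Ioi (0 : ℝ), Real.exp (psiPhase Q (-x) s) * (1 + s) ^ r
      ≤ Real.exp (psiPhase Q (-x) T) * ∫ s in Ioi (0 : ℝ), (1 + s) ^ r := by
  rw [← integral_const_mul]
  refine setIntegral_mono_on (integrableOn_exp_psiPhase hx hT hQ hr)
    ((integrableOn_one_add_rpow hr).const_mul _) measurableSet_Ioi fun s hs => ?_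
  have hs : 0 < s := hs
  gcongr
  exact psiPhase_le hx hT hQ hs

lemma le_integral_exp_psiPhase (hx : 1 ≤ x) (hT : 0 < T)
    (hQ : Q = x * (T * (T + 1))) (hr : r < -1) :
    √(T / x) * (Real.exp (psiPhase Q (-x) T - 1) * (2 * (1 + T)) ^ r)
      ≤ ∫ s in Ioi (0 : ℝ), Real.exp (psiPhase Q (-x) s) * (1 + s) ^ r := by
  have hx0 : 0 < x := by linarith
  have hint := integrableOn_exp_psiPhase hx0.le hT hQ hr
  have hsub : Ioc T (T + √(T / x)) ⊆ Ioi 0 := fun s hs => hT.trans hs.1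
  have hsqrt : √(T / x) ≤ 1 + T := by
    rw [Real.sqrt_le_left (by positivity)]
    have : T / x ≤ T := div_le_self hT.le hx
    nlinarith
  have hconst : √(T / x) * (Real.exp (psiPhase Q (-x) T - 1) * (2 * (1 + T)) ^ r)
      = ∫ _ in Ioc T (T + √(T / x)),
          Real.exp (psiPhase Q (-x) T - 1) * (2 * (1 + T)) ^ r := by
    simp [measureReal_def]
  rw [hconst]
  refine (setIntegral_mono_on (integrableOn_const (by simp)) (hint.mono_set hsub) measurableSet_Ioc
    fun s hs => ?_).trans (setIntegral_mono_set hint ?_ hsub.eventuallyLE)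
  · have hs0 : 0 < s := hsub hs
    have hdist : x * (s - T) ^ 2 / T ≤ 1 := by
      have h0 : 0 ≤ s - T := by linarith [hs.1]
      have h1 : (s - T) ^ 2 ≤ T / x := by
        rw [← Real.le_sqrt h0 (by positivity)]
        linarith [hs.2]
      rw [div_le_one hT]
      calc x * (s - T) ^ 2 ≤ x * (T / x) := by gcongr
        _ = T := by field_simp
    have hphase := psiPhase_sub_le hx0.le hT hQ hs.1.le
    refine mul_le_mul (Real.exp_le_exp.2 (by linarith)) ?_ (by positivity) (by positivity)
    exact Real.rpow_le_rpow_of_nonpos (by positivity) (by linarith [hs.2]) (by linarith)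
  · filter_upwards [ae_restrict_mem measurableSet_Ioi] with s hs
    have hs : 0 < s := hs
    show 0 ≤ Real.exp (psiPhase Q (-x) s) * (1 + s) ^ r
    positivity

lemma rpow_mul_inv_le_sqrt_mul_rpow (hx : 1 ≤ x) (hT : 0 < T) (hQ : Q = x * (T * (T + 1)))
    (hQ1 : 1 ≤ Q) {p : ℝ} (hp0 : 0 ≤ p) (hp : p ≤ 1 / 2) :
    Q ^ (-p) * x⁻¹ ≤ 4 * (√(T / x) * (1 + T) ^ (-(1 / 2) - 2 * p)) := by
  have hx0 : 0 < x := by linarith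
  have hxT : (1 + T) / 4 ≤ x * T := by
    rcases le_or_gt 1 T with h | h
    · nlinarith
    · nlinarith [mul_pos hx0 hT]
  have hQT : ((1 + T) / 2) ^ 2 ≤ Q := by nlinarith
  have hQp : Q ^ (-p) ≤ 2 * (1 + T) ^ (-(2 * p)) := by
    calc Q ^ (-p) ≤ (((1 + T) / 2) ^ 2) ^ (-p) :=
          Real.rpow_le_rpow_of_nonpos (by positivity) hQT (by linarith)
      _ = ((1 + T) / 2) ^ (-(2 * p)) := by
          rw [← Real.rpow_natCast, ← Real.rpow_mul (by positivity)]
          congr 1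
          push_cast
          ring
      _ = 2 ^ (2 * p) * (1 + T) ^ (-(2 * p)) := by
          rw [Real.div_rpow (by positivity) (by norm_num), Real.rpow_neg (by norm_num : (0:ℝ) ≤ 2)]
          field_simp
      _ ≤ 2 * (1 + T) ^ (-(2 * p)) := by
          gcongr
          calc (2 : ℝ) ^ (2 * p) ≤ 2 ^ (1 : ℝ) :=
                Real.rpow_le_rpow_of_exponent_le (by norm_num) (by linarith)
            _ = 2 := Real.rpow_one 2
  have hsqrt : x⁻¹ ≤ 2 * (√(T / x) * (1 + T) ^ (-(1 / 2) : ℝ)) := by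
    rw [Real.rpow_neg (by positivity), ← Real.sqrt_eq_rpow, ← Real.sqrt_inv, ← Real.sqrt_mul
      (by positivity), ← div_le_iff₀' (by norm_num)]
    refine Real.le_sqrt_of_sq_le ?_
    field_simp
    linarith
  calc Q ^ (-p) * x⁻¹
      ≤ (2 * (1 + T) ^ (-(2 * p))) * (2 * (√(T / x) * (1 + T) ^ (-(1 / 2) : ℝ))) := by gcongr
    _ = 4 * (√(T / x) * (1 + T) ^ (-(1 / 2) - 2 * p)) := by
        rw [sub_eq_add_neg, Real.rpow_add (by positivity)]
        ring

end

/-- For an integer `n ≥ 3`, `α = 1 − 1/n`, there is a constant `C > 1` depending only on `n`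
such that for every `β ≤ 0` with `Q := α − β − 1 ≥ 1` and every `y ≤ −1`:
`C⁻¹ · Q^{−1/4−1/(2n)} · (−y)⁻¹ · e^{y+F(t₀)}/Γ(Q+1) ≤ Ψ♭(β, α, y)
  ≤ C · Q^{1/4} · e^{y+F(t₀)}/Γ(Q+1)`,
where `F(t) = y·t + Q·log(t/(t+1))` and `t₀ = (1/2)·(−1 + √(1 + 4Q/(−y)))`. -/
theorem PsiFlat_bounds_large_Q (n : ℕ) (hn : 3 ≤ n) :
    ∃ C : ℝ, 1 < C ∧ ∀ β : ℝ, β ≤ 0 →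
      ∀ Q : ℝ, Q = (1 - 1 / (n : ℝ)) - β - 1 → 1 ≤ Q →
      ∀ y : ℝ, y ≤ -1 →
      ∀ t₀ : ℝ, t₀ = (1 / 2) * (-1 + Real.sqrt (1 + 4 * Q / (-y))) →
        C⁻¹ * Q ^ (-(1 : ℝ) / 4 - 1 / (2 * (n : ℝ))) *
            ((-y)⁻¹ * Real.exp (y + (y * t₀ + Q * Real.log (t₀ / (t₀ + 1)))) /
              Real.Gamma (Q + 1))
          ≤ PsiFlat β (1 - 1 / (n : ℝ)) y ∧
        PsiFlat β (1 - 1 / (n : ℝ)) y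
          ≤ C * Q ^ ((1 : ℝ) / 4) *
              (Real.exp (y + (y * t₀ + Q * Real.log (t₀ / (t₀ + 1)))) / Real.Gamma (Q + 1)) := by
  have hn3 : (3 : ℝ) ≤ n := by exact_mod_cast hn
  have hninv : 0 < 1 / (n : ℝ) := by positivity
  have hninv3 : 1 / (n : ℝ) ≤ 1 / 3 := one_div_le_one_div_of_le (by norm_num) hn3
  set r : ℝ := -1 - 1 / (n : ℝ) with hrdef
  have hr : r < -1 := by linarith
  set J : ℝ := ∫ s in Ioi (0 : ℝ), (1 + s) ^ r with hJ
  have hJ0 : 0 ≤ J := setIntegral_nonneg measurableSet_Ioi fun s hs => by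
    have hs : 0 < s := hs
    positivity
  refine ⟨J + 16 * Real.exp 1, by linarith [Real.add_one_le_exp 1], ?_⟩
  intro β _ Q hQ hQ1 y hy T hT
  obtain ⟨x, rfl⟩ : ∃ x, y = -x := ⟨-y, by ring⟩
  rw [neg_neg] at hT
  have hx : 1 ≤ x := by linarith
  have hx0 : 0 < x := by linarith
  have hQ0 : 0 < Q := by linarith
  have hT0 : 0 < T := by
    have : 1 < √(1 + 4 * Q / x) := by
      rw [Real.lt_sqrt (by norm_num)]
      have : 0 < 4 * Q / x := by positivity
      linarith
    linarith
  have hQT : Q = x * (T * (T + 1)) := by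
    have hsq := Real.sq_sqrt (show 0 ≤ 1 + 4 * Q / x by positivity)
    have h4 : T * (T + 1) = Q / x := by
      rw [hT]
      linear_combination hsq / 4
    rw [h4]
    field_simp
  have hPsi : PsiFlat β (1 - 1 / (n : ℝ)) (-x) = Real.exp (-x) / Real.Gamma (Q + 1) *
      ∫ s in Ioi (0 : ℝ), Real.exp (psiPhase Q (-x) s) * (1 + s) ^ r := by
    rw [PsiFlat, show 1 - 1 / (n : ℝ) - β = Q + 1 by linarith]
    congr 1
    refine setIntegral_congr_fun measurableSet_Ioi fun s hs => ?_
    rw [← exp_mul_rpow_mul_rpow_eq hs, show Q + 1 - 1 = Q by ring,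
      show β - 1 = r - Q by rw [hrdef]; linarith]
  have hGamma : 0 < Real.Gamma (Q + 1) := Real.Gamma_pos_of_pos (by linarith)
  rw [hPsi, neg_neg]
  change _ * (x⁻¹ * Real.exp (-x + psiPhase Q (-x) T) / _) ≤ _ ∧
    _ ≤ _ * (Real.exp (-x + psiPhase Q (-x) T) / _)
  rw [Real.exp_add]
  set E := Real.exp (psiPhase Q (-x) T) with hE
  set G := Real.exp (-x) / Real.Gamma (Q + 1) with hG
  have hG0 : 0 < G := by positivity
  constructor
  · have hlow := le_integral_exp_psiPhase hx hT0 hQT hr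
    have hpow := rpow_mul_inv_le_sqrt_mul_rpow hx hT0 hQT hQ1
      (p := 1 / 4 + 1 / (2 * (n : ℝ))) (by positivity) (by
        rw [show 1 / (2 * (n : ℝ)) = 1 / (n : ℝ) / 2 by ring]; linarith)
    rw [show -(1 / 4 + 1 / (2 * (n : ℝ))) = -(1 : ℝ) / 4 - 1 / (2 * (n : ℝ)) by ring,
      show -(1 / 2) - 2 * (1 / 4 + 1 / (2 * (n : ℝ))) = r by rw [hrdef]; ring] at hpow
    have h2r : (1 / 4 : ℝ) ≤ 2 ^ r := by
      calc (1 / 4 : ℝ) = 2 ^ (-2 : ℝ) := by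
            rw [Real.rpow_neg (by norm_num), Real.rpow_two]; norm_num
        _ ≤ 2 ^ r := Real.rpow_le_rpow_of_exponent_le (by norm_num) (by linarith)
    have hC : (J + 16 * Real.exp 1)⁻¹ ≤ (16 * Real.exp 1)⁻¹ :=
      inv_anti₀ (by positivity) (by linarith)
    calc (J + 16 * Real.exp 1)⁻¹ * Q ^ (-(1 : ℝ) / 4 - 1 / (2 * (n : ℝ))) *
          (x⁻¹ * (Real.exp (-x) * E) / Real.Gamma (Q + 1))
        = G * ((J + 16 * Real.exp 1)⁻¹ *
            (Q ^ (-(1 : ℝ) / 4 - 1 / (2 * (n : ℝ))) * x⁻¹) * E) := by rw [hG]; ring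
      _ ≤ G * ((16 * Real.exp 1)⁻¹ * (4 * (√(T / x) * (1 + T) ^ r)) * E) := by gcongr
      _ = G * (√(T / x) * (Real.exp (psiPhase Q (-x) T - 1) * (1 / 4 * (1 + T) ^ r))) := by
          rw [Real.exp_sub, ← hE]
          field_simp
          ring
      _ ≤ G * (√(T / x) * (Real.exp (psiPhase Q (-x) T - 1) * (2 ^ r * (1 + T) ^ r))) := by
          gcongr
      _ ≤ _ := by
          rw [← Real.mul_rpow (by norm_num) (by positivity)]
          gcongr
  · have hup := integral_exp_psiPhase_le hx0.le hT0 hQT hr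
    have hQpow : 1 ≤ Q ^ ((1 : ℝ) / 4) := Real.one_le_rpow hQ1 (by norm_num)
    have hC : J ≤ (J + 16 * Real.exp 1) * Q ^ ((1 : ℝ) / 4) :=
      (le_add_of_nonneg_right (by positivity)).trans
        (le_mul_of_one_le_right (by positivity) hQpow)
    calc _ ≤ G * (E * J) := by gcongr
      _ ≤ G * (E * ((J + 16 * Real.exp 1) * Q ^ ((1 : ℝ) / 4))) := by gcongr
      _ = _ := by rw [hG]; ring
end

section
/- Let n ≥ 3 be an integer, set α = 1 − 1/n and γ_n = 1/2 + 1/n, and let β ≤ 0 with Q := α − β − 1 satisfying Q ≥ 1. There exists a constant C > 1, depending only on n, such that for all y ≤ −1: C^{-1} · Q^{−1/4} · (−y)^{(2−n)/(4n)} · e^{y + G(u₀)} / Γ(Q+1) ≤ Φ♯(β, α, y) ≤ C · (−y)^{(2−n)/(4n)} · e^{y + G(u₀)} / Γ(Q+1), where G(u) = −u² + 2·(−y)^{1/2}·u + (2Q + γ_n)·log u and u₀ = ((−y)^{1/2}/2)·(1 + √(1 + 4Q/(−y) + 2γ_n/(−y))). -/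
open Real Set MeasureTheory

lemma besselI_eq_sub (ν z : ℝ) :
    besselI ν z = (1 / π) * (∫ θ in (0 : ℝ)..π, exp (z * cos θ) * cos (ν * θ)) -
      sin (ν * π) / π * ∫ t in Ioi (0 : ℝ), exp (-z * cosh t - ν * t) := by
  unfold besselI
  rw [intervalIntegral.integral_sub (Continuous.intervalIntegrable (by fun_prop) _ _) (by simp),
    intervalIntegral.integral_const, smul_eq_mul, sub_zero, mul_sub, ← mul_assoc (1 / π) π,
    one_div_mul_cancel pi_ne_zero, one_mul]

lemma stronglyMeasurable_besselI (ν : ℝ) : StronglyMeasurable (besselI ν) := by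
  rw [funext (besselI_eq_sub ν)]
  simp only [intervalIntegral.integral_of_le pi_pos.le]
  refine .sub (StronglyMeasurable.const_mul ?_ _) (StronglyMeasurable.const_mul ?_ _)
  · exact StronglyMeasurable.integral_prod_right (Continuous.stronglyMeasurable (by fun_prop))
  · exact StronglyMeasurable.integral_prod_right (Continuous.stronglyMeasurable (by fun_prop))

lemma sin_mul_pi_nonpos {ν : ℝ} (h₀ : -(1 / 3) ≤ ν) (h₁ : ν ≤ 0) : sin (ν * π) ≤ 0 :=
  sin_nonpos_of_nonpos_of_neg_pi_le (mul_nonpos_of_nonpos_of_nonneg h₁ pi_pos.le)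
    (by nlinarith [pi_pos])

lemma half_le_cos_mul_s17 {ν θ : ℝ} (h₀ : -(1 / 3) ≤ ν) (h₁ : ν ≤ 0) (hθ : θ ∈ Icc 0 π) :
    1 / 2 ≤ cos (ν * θ) := by
  rw [← cos_neg, ← cos_pi_div_three]
  have := pi_pos
  apply cos_le_cos_of_nonneg_of_le_pi
  · nlinarith [hθ.1]
  · linarith
  · nlinarith [hθ.1, hθ.2]

lemma half_integral_le_besselI {ν : ℝ} (h₀ : -(1 / 3) ≤ ν) (h₁ : ν ≤ 0) (z : ℝ) :
    (1 / π) * ∫ θ in (0 : ℝ)..π, exp (z * cos θ) * (1 / 2) ≤ besselI ν z := by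
  rw [besselI_eq_sub]
  have hs := sin_mul_pi_nonpos h₀ h₁
  have hpos : 0 ≤ ∫ t in Ioi (0 : ℝ), exp (-z * cosh t - ν * t) :=
    setIntegral_nonneg measurableSet_Ioi fun t _ => (exp_pos _).le
  have hm : ∫ θ in (0 : ℝ)..π, exp (z * cos θ) * (1 / 2) ≤
      ∫ θ in (0 : ℝ)..π, exp (z * cos θ) * cos (ν * θ) := by
    apply intervalIntegral.integral_mono_on pi_pos.le
    · exact Continuous.intervalIntegrable (by fun_prop) _ _
    · exact Continuous.intervalIntegrable (by fun_prop) _ _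
    · intro θ hθ
      exact mul_le_mul_of_nonneg_left (half_le_cos_mul_s17 h₀ h₁ hθ) (exp_pos _).le
  have h2 : sin (ν * π) / π * ∫ t in Ioi (0 : ℝ), exp (-z * cosh t - ν * t) ≤ 0 :=
    mul_nonpos_of_nonpos_of_nonneg (div_nonpos_of_nonpos_of_nonneg hs pi_pos.le) hpos
  have h3 := mul_le_mul_of_nonneg_left hm (show 0 ≤ 1 / π by positivity)
  linarith

lemma besselI_nonneg {ν : ℝ} (h₀ : -(1 / 3) ≤ ν) (h₁ : ν ≤ 0) (z : ℝ) : 0 ≤ besselI ν z := by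
  refine le_trans (mul_nonneg (by positivity) ?_) (half_integral_le_besselI h₀ h₁ z)
  exact intervalIntegral.integral_nonneg pi_pos.le fun θ _ => by positivity

lemma le_besselI {ν z : ℝ} (h₀ : -(1 / 3) ≤ ν) (h₁ : ν ≤ 0) (hz : 1 ≤ z) :
    exp (-1 / 2) / (2 * π) * (exp z * (√z)⁻¹) ≤ besselI ν z := by
  refine le_trans ?_ (half_integral_le_besselI h₀ h₁ z)
  have hs : 1 ≤ √z := one_le_sqrt.mpr hz
  have hi : (√z)⁻¹ ≤ 1 := inv_le_one_of_one_le₀ hs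
  have hi0 : 0 < (√z)⁻¹ := by positivity
  have hcont : Continuous fun θ : ℝ => exp (z * cos θ) * (1 / 2) := by fun_prop
  have hle : ∫ θ in (0 : ℝ)..(√z)⁻¹, exp (z * cos θ) * (1 / 2) ≤
      ∫ θ in (0 : ℝ)..π, exp (z * cos θ) * (1 / 2) := by
    apply intervalIntegral.integral_mono_interval le_rfl hi0.le (by linarith [pi_gt_three])
    · exact .of_forall fun θ => by positivity
    · exact hcont.intervalIntegrable _ _
  have hlow : ∫ _θ in (0 : ℝ)..(√z)⁻¹, exp (-1 / 2) * exp z * (1 / 2) ≤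
      ∫ θ in (0 : ℝ)..(√z)⁻¹, exp (z * cos θ) * (1 / 2) := by
    apply intervalIntegral.integral_mono_on hi0.le (by simp) (hcont.intervalIntegrable _ _)
    intro θ hθ
    rw [← exp_add]
    gcongr
    have hsq : θ ^ 2 ≤ z⁻¹ := by
      calc θ ^ 2 ≤ ((√z)⁻¹) ^ 2 := pow_le_pow_left₀ hθ.1 hθ.2 2
        _ = z⁻¹ := by rw [inv_pow, sq_sqrt (by linarith)]
    have hz2 : z * θ ^ 2 ≤ 1 := by
      calc z * θ ^ 2 ≤ z * z⁻¹ := by gcongr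
        _ = 1 := mul_inv_cancel₀ (by linarith)
    nlinarith [one_sub_sq_div_two_le_cos (x := θ)]
  rw [intervalIntegral.integral_const, smul_eq_mul, sub_zero] at hlow
  calc exp (-1 / 2) / (2 * π) * (exp z * (√z)⁻¹)
      = 1 / π * ((√z)⁻¹ * (exp (-1 / 2) * exp z * (1 / 2))) := by field_simp
    _ ≤ _ := by gcongr; exact hlow.trans hle

lemma integral_exp_mul_cos_le_s17 {ν z : ℝ} (hz : 0 < z) :
    ∫ θ in (0 : ℝ)..π, exp (z * cos θ) * cos (ν * θ) ≤ √(π ^ 3 / 2) / 2 * (exp z * (√z)⁻¹) := by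
  have hb : 0 < 2 / π ^ 2 * z := by positivity
  have hint := (integrable_exp_neg_mul_sq hb).const_mul (exp z)
  calc ∫ θ in (0 : ℝ)..π, exp (z * cos θ) * cos (ν * θ)
      ≤ ∫ θ in (0 : ℝ)..π, exp z * exp (-(2 / π ^ 2 * z) * θ ^ 2) := by
        apply intervalIntegral.integral_mono_on pi_pos.le
        · exact Continuous.intervalIntegrable (by fun_prop) _ _
        · exact Continuous.intervalIntegrable (by fun_prop) _ _
        · intro θ hθ
          refine (mul_le_of_le_one_right (exp_pos _).le (cos_le_one _)).trans ?_
          rw [← exp_add]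
          gcongr
          have := cos_le_one_sub_mul_cos_sq (x := θ)
            (by rw [abs_of_nonneg hθ.1]; exact hθ.2)
          nlinarith
    _ ≤ ∫ θ in Ioi (0 : ℝ), exp z * exp (-(2 / π ^ 2 * z) * θ ^ 2) := by
        rw [intervalIntegral.integral_of_le pi_pos.le]
        refine setIntegral_mono_set hint.integrableOn ?_ (.of_forall Ioc_subset_Ioi_self)
        exact .of_forall fun θ => by positivity
    _ = √(π ^ 3 / 2) / 2 * (exp z * (√z)⁻¹) := by
        rw [integral_const_mul, integral_gaussian_Ioi,
          show π / (2 / π ^ 2 * z) = π ^ 3 / 2 / z by field_simp,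
          sqrt_div (by positivity)]
        ring

lemma exp_neg_le_inv_sqrt {w : ℝ} (hw : 0 < w) : exp (-w) ≤ (√w)⁻¹ := by
  rw [exp_neg]
  have : √w ≤ exp w := by
    nlinarith [add_one_le_exp w, sq_sqrt hw.le, sq_nonneg (√w - 1), sqrt_nonneg w]
  gcongr

lemma integral_exp_neg_mul_cosh_le {ν z : ℝ} (h₀ : -(1 / 3) ≤ ν) (hz : 0 < z) :
    ∫ t in Ioi (0 : ℝ), exp (-z * cosh t - ν * t) ≤ 6 * √2 * (exp z * (√z)⁻¹) := by
  have hint := (exp_neg_integrableOn_Ioi 0 (show (0 : ℝ) < 1 / 6 by norm_num)).const_mul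
    (√2 * (√z)⁻¹)
  calc ∫ t in Ioi (0 : ℝ), exp (-z * cosh t - ν * t)
      ≤ ∫ t in Ioi (0 : ℝ), √2 * (√z)⁻¹ * exp (-(1 / 6) * t) := by
        refine integral_mono_of_nonneg (.of_forall fun t => (exp_pos _).le) hint ?_
        filter_upwards [ae_restrict_mem measurableSet_Ioi] with t ht
        have ht : 0 < t := ht
        have hc : exp t / 2 ≤ cosh t := by
          rw [cosh_eq]; linarith [exp_pos (-t)]
        have hw : 0 < z * (exp t / 2) := by positivity
        calc exp (-z * cosh t - ν * t) ≤ exp (-(z * (exp t / 2)) + t / 3) := by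
              gcongr; nlinarith
          _ = exp (-(z * (exp t / 2))) * exp (t / 3) := exp_add _ _
          _ ≤ (√(z * (exp t / 2)))⁻¹ * exp (t / 3) := by
              gcongr; exact exp_neg_le_inv_sqrt hw
          _ = √2 * (√z)⁻¹ * (exp (-(t / 2)) * exp (t / 3)) := by
              rw [sqrt_mul hz.le, sqrt_div (exp_pos t).le, ← exp_half, exp_neg]
              field_simp
          _ = √2 * (√z)⁻¹ * exp (-(1 / 6) * t) := by rw [← exp_add]; ring_nf
    _ = 6 * √2 * (√z)⁻¹ := by
        rw [integral_const_mul, integral_exp_mul_Ioi (by norm_num)]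
        simp; ring
    _ ≤ 6 * √2 * (exp z * (√z)⁻¹) := by
        gcongr
        exact le_mul_of_one_le_left (by positivity) (one_le_exp hz.le)

lemma exists_besselI_le : ∃ K : ℝ, 0 < K ∧ ∀ ν z : ℝ, -(1 / 3) ≤ ν → 0 < z →
    besselI ν z ≤ K * (exp z * (√z)⁻¹) := by
  refine ⟨1 / π * (√(π ^ 3 / 2) / 2) + 1 / π * (6 * √2), by positivity, fun ν z h₀ hz => ?_⟩
  rw [besselI_eq_sub]
  have hpos : 0 ≤ ∫ t in Ioi (0 : ℝ), exp (-z * cosh t - ν * t) :=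
    setIntegral_nonneg measurableSet_Ioi fun t _ => (exp_pos _).le
  have hs : -(1 / π) ≤ sin (ν * π) / π := by
    rw [← neg_div]; gcongr; exact neg_one_le_sin _
  have h1 := mul_le_mul_of_nonneg_left (integral_exp_mul_cos_le_s17 (ν := ν) hz)
    (show 0 ≤ 1 / π by positivity)
  have h2 := mul_le_mul_of_nonneg_left (integral_exp_neg_mul_cosh_le h₀ hz)
    (show 0 ≤ 1 / π by positivity)
  have h3 := mul_le_mul_of_nonneg_right hs hpos
  linarith

/-- The ratio of `I_ν(z)` to `e^z z^{-1/2}`. -/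
noncomputable def besselRatio (ν z : ℝ) : ℝ := besselI ν z * (√z / exp z)

lemma stronglyMeasurable_besselRatio (ν : ℝ) : StronglyMeasurable (besselRatio ν) :=
  (stronglyMeasurable_besselI ν).mul <|
    (continuous_sqrt.div continuous_exp fun z => (exp_pos z).ne').stronglyMeasurable

lemma besselRatio_nonneg {ν : ℝ} (h₀ : -(1 / 3) ≤ ν) (h₁ : ν ≤ 0) (z : ℝ) :
    0 ≤ besselRatio ν z :=
  mul_nonneg (besselI_nonneg h₀ h₁ z) (by positivity)

lemma le_besselRatio {ν z : ℝ} (h₀ : -(1 / 3) ≤ ν) (h₁ : ν ≤ 0) (hz : 1 ≤ z) :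
    exp (-1 / 2) / (2 * π) ≤ besselRatio ν z := by
  have hs : 0 < √z := sqrt_pos.mpr (by linarith)
  calc exp (-1 / 2) / (2 * π)
      = exp (-1 / 2) / (2 * π) * (exp z * (√z)⁻¹) * (√z / exp z) := by field_simp
    _ ≤ besselRatio ν z := mul_le_mul_of_nonneg_right (le_besselI h₀ h₁ hz) (by positivity)

lemma exists_besselRatio_le : ∃ K : ℝ, 0 < K ∧ ∀ ν z : ℝ, -(1 / 3) ≤ ν → 0 < z →
    besselRatio ν z ≤ K := by
  obtain ⟨K, hK, h⟩ := exists_besselI_le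
  refine ⟨K, hK, fun ν z h₀ hz => ?_⟩
  have hs : 0 < √z := sqrt_pos.mpr hz
  calc besselRatio ν z ≤ K * (exp z * (√z)⁻¹) * (√z / exp z) :=
        mul_le_mul_of_nonneg_right (h ν z h₀ hz) (by positivity)
    _ = K := by field_simp

lemma besselI_eq_besselRatio_mul {ν z : ℝ} (hz : 0 < z) :
    besselI ν z = besselRatio ν z * (exp z / √z) := by
  have hs : 0 < √z := sqrt_pos.mpr hz
  unfold besselRatio
  field_simp

lemma integrand_substitution {ν Q x u : ℝ} (hx : 0 < x) (hu : 0 < u) :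
    (2 * u ^ ((2 : ℝ) - 1)) • (exp (x * u ^ (2 : ℝ) / -x) * (x * u ^ (2 : ℝ)) ^ (Q - ν / 2) *
        besselI ν (2 * √(x * u ^ (2 : ℝ)))) =
      √2 * x ^ (Q - ν / 2 - 1 / 4) *
        (exp (-u ^ 2 + 2 * √x * u + (2 * Q + (1 / 2 - ν)) * log u) *
          besselRatio ν (2 * √x * u)) := by
  have hsx : 0 < √x := sqrt_pos.mpr hx
  have h2 : √(x * u ^ (2 : ℝ)) = √x * u := by
    rw [rpow_two, sqrt_mul hx.le, sqrt_sq hu.le]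
  have he : x * u ^ (2 : ℝ) / -x = -u ^ 2 := by rw [rpow_two]; field_simp
  rw [h2, he, ← mul_assoc 2, besselI_eq_besselRatio_mul (by positivity), smul_eq_mul,
    exp_add, mul_assoc 2 (√x), sqrt_mul (by norm_num)]
  have key : u ^ ((2 : ℝ) - 1) * (x * u ^ (2 : ℝ)) ^ (Q - ν / 2) / √(√x * u) =
      x ^ (Q - ν / 2 - 1 / 4) * exp ((2 * Q + (1 / 2 - ν)) * log u) := by
    obtain ⟨X, rfl⟩ : ∃ X, x = exp X := ⟨log x, (exp_log hx).symm⟩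
    obtain ⟨U, rfl⟩ : ∃ U, u = exp U := ⟨log u, (exp_log hu).symm⟩
    simp only [← exp_half, ← exp_mul, ← exp_add, ← exp_sub, log_exp]
    congr 1
    ring
  calc _ = (2 / √2) * (u ^ ((2 : ℝ) - 1) * (x * u ^ (2 : ℝ)) ^ (Q - ν / 2) / √(√x * u)) *
        (exp (-u ^ 2) * exp (2 * (√x * u)) * besselRatio ν (2 * (√x * u))) := by
        field_simp
    _ = _ := by
        rw [key, div_sqrt, exp_add (-u ^ 2)]
        ring

lemma PhiSharp_eq {ν Q x : ℝ} (hx : 0 < x) :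
    PhiSharp (ν - Q) (ν + 1) (-x) =
      √2 * Gamma (ν + 1) * (x ^ (-ν / 2 - 1 / 4) * exp (-x) / Gamma (Q + 1)) *
        ∫ u in Ioi (0 : ℝ), exp (-u ^ 2 + 2 * √x * u + (2 * Q + (1 / 2 - ν)) * log u) *
          besselRatio ν (2 * √x * u) := by
  set h : ℝ → ℝ := fun s => exp (s / -x) * s ^ (Q - ν / 2) * besselI ν (2 * √s) with hh
  have hint : ∫ s in Ioi (0 : ℝ), h s = x * (√2 * x ^ (Q - ν / 2 - 1 / 4) *
      ∫ u in Ioi (0 : ℝ), exp (-u ^ 2 + 2 * √x * u + (2 * Q + (1 / 2 - ν)) * log u) *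
          besselRatio ν (2 * √x * u)) := by
    have e1 := integral_comp_mul_left_Ioi h 0 hx
    rw [mul_zero, smul_eq_mul, ← integral_comp_rpow_Ioi_of_pos (p := 2) (by norm_num),
      setIntegral_congr_fun measurableSet_Ioi
        (fun u hu => integrand_substitution (ν := ν) (Q := Q) hx hu), integral_const_mul] at e1
    rw [e1, mul_inv_cancel_left₀ hx.ne']
  have hP : PhiSharp (ν - Q) (ν + 1) (-x) = Gamma (ν + 1) / Gamma (Q + 1) * exp (-x) *
      x ^ (-(Q + 1)) * ∫ s in Ioi (0 : ℝ), h s := by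
    unfold PhiSharp
    rw [hh, show ν + 1 - (ν - Q) = Q + 1 by ring, neg_neg, add_sub_cancel_right,
      show ν - Q - (ν + 1) = -(Q + 1) by ring, show ν / 2 - (ν - Q) = Q - ν / 2 by ring]
  have hpow : x ^ (-ν / 2 - 1 / 4) = x ^ (-(Q + 1)) * x * x ^ (Q - ν / 2 - 1 / 4) := by
    rw [← rpow_add_one hx.ne', ← rpow_add hx]
    ring_nf
  rw [hP, hint, hpow]
  ring

section Laplace

variable {r a u₀ : ℝ}

lemma exponent_le_of_critical (hu₀ : 0 < u₀) (ha : 0 < a) (hc : 2 * r * u₀ = 2 * u₀ ^ 2 - a)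
    {u : ℝ} (hu : 0 < u) :
    -u ^ 2 + 2 * r * u + a * log u ≤
      -u₀ ^ 2 + 2 * r * u₀ + a * log u₀ + -1 * (u - u₀) ^ 2 := by
  have hl : log u - log u₀ ≤ u / u₀ - 1 := by
    rw [← log_div hu.ne' hu₀.ne']
    exact log_le_sub_one_of_pos (by positivity)
  have h1 := mul_le_mul_of_nonneg_left hl ha.le
  have h2 : 2 * r = 2 * u₀ - a / u₀ := by field_simp; linarith
  have h3 : a * (u / u₀ - 1) = a / u₀ * (u - u₀) := by field_simp
  rw [h2]
  nlinarith

lemma le_exponent_of_critical (hu₀ : 0 < u₀) (ha : 0 < a) (hr : 0 ≤ r)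
    (hc : 2 * r * u₀ = 2 * u₀ ^ 2 - a) {u : ℝ} (hu : u₀ ≤ u) :
    -u₀ ^ 2 + 2 * r * u₀ + a * log u₀ - 3 * (u - u₀) ^ 2 ≤
      -u ^ 2 + 2 * r * u + a * log u := by
  have hup : 0 < u := hu₀.trans_le hu
  have hl : 1 - u₀ / u ≤ log u - log u₀ := by
    rw [← log_div hup.ne' hu₀.ne']
    simpa using one_sub_inv_le_log_of_pos (show 0 < u / u₀ by positivity)
  have h1 := mul_le_mul_of_nonneg_left hl ha.le
  have h2 : 2 * r = 2 * u₀ - a / u₀ := by field_simp; linarith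
  have h3 : a / u₀ * (u - u₀) - 2 * (u - u₀) ^ 2 ≤ a * (1 - u₀ / u) := by
    have h4 : a / u₀ * (u - u₀) - a * (1 - u₀ / u) = a / (u₀ * u) * (u - u₀) ^ 2 := by
      field_simp
    have h5 : a / (u₀ * u) ≤ 2 := by
      rw [div_le_iff₀ (by positivity)]
      nlinarith [mul_nonneg hr hu₀.le]
    nlinarith [mul_le_mul_of_nonneg_right h5 (sq_nonneg (u - u₀))]
  rw [h2]
  nlinarith

lemma integrable_gaussian_sub (c : ℝ) : Integrable fun u : ℝ => exp (-1 * (u - c) ^ 2) :=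
  (integrable_exp_neg_mul_sq one_pos).comp_sub_right c

lemma exp_mul_le_gaussian {R : ℝ → ℝ} {K : ℝ} (hu₀ : 0 < u₀) (ha : 0 < a)
    (hc : 2 * r * u₀ = 2 * u₀ ^ 2 - a) (hK : 0 ≤ K) (hR : ∀ u, 0 < u → R u ≤ K) {u : ℝ}
    (hu : 0 < u) :
    exp (-u ^ 2 + 2 * r * u + a * log u) * R u ≤
      K * exp (-u₀ ^ 2 + 2 * r * u₀ + a * log u₀) * exp (-1 * (u - u₀) ^ 2) := by
  rw [mul_assoc K, ← exp_add, mul_comm K]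
  have := exponent_le_of_critical hu₀ ha hc hu
  exact mul_le_mul_of_nonneg (exp_le_exp.mpr this) (hR u hu) (exp_pos _).le hK

lemma laplace_upper_bound {R : ℝ → ℝ} {K : ℝ} (hu₀ : 0 < u₀) (ha : 0 < a)
    (hc : 2 * r * u₀ = 2 * u₀ ^ 2 - a) (hK : 0 ≤ K) (hR₀ : ∀ u, 0 ≤ R u)
    (hR : ∀ u, 0 < u → R u ≤ K) :
    ∫ u in Ioi (0 : ℝ), exp (-u ^ 2 + 2 * r * u + a * log u) * R u ≤
      K * √π * exp (-u₀ ^ 2 + 2 * r * u₀ + a * log u₀) := by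
  have hint := (integrable_gaussian_sub u₀).const_mul
    (K * exp (-u₀ ^ 2 + 2 * r * u₀ + a * log u₀))
  calc ∫ u in Ioi (0 : ℝ), exp (-u ^ 2 + 2 * r * u + a * log u) * R u
      ≤ ∫ u in Ioi (0 : ℝ), K * exp (-u₀ ^ 2 + 2 * r * u₀ + a * log u₀) *
          exp (-1 * (u - u₀) ^ 2) := by
        refine integral_mono_of_nonneg
          (.of_forall fun u => mul_nonneg (exp_pos _).le (hR₀ u)) hint.integrableOn ?_
        filter_upwards [ae_restrict_mem measurableSet_Ioi] with u hu
        exact exp_mul_le_gaussian hu₀ ha hc hK hR hu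
    _ ≤ ∫ u, K * exp (-u₀ ^ 2 + 2 * r * u₀ + a * log u₀) * exp (-1 * (u - u₀) ^ 2) :=
        setIntegral_le_integral hint (.of_forall fun u => by positivity)
    _ = K * √π * exp (-u₀ ^ 2 + 2 * r * u₀ + a * log u₀) := by
        rw [integral_const_mul, integral_sub_right_eq_self (fun u => exp (-1 * u ^ 2)) u₀,
          integral_gaussian, div_one]
        ring

lemma laplace_lower_bound {R : ℝ → ℝ} {K c : ℝ} (hu₀ : 0 < u₀) (ha : 0 < a) (hr : 0 ≤ r)
    (hc : 2 * r * u₀ = 2 * u₀ ^ 2 - a) (hRm : StronglyMeasurable R) (hK : 0 ≤ K)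
    (hR₀ : ∀ u, 0 ≤ R u) (hR : ∀ u, 0 < u → R u ≤ K) (hc₀ : 0 ≤ c)
    (hRc : ∀ u, u₀ ≤ u → c ≤ R u) :
    c * exp (-3) * exp (-u₀ ^ 2 + 2 * r * u₀ + a * log u₀) ≤
      ∫ u in Ioi (0 : ℝ), exp (-u ^ 2 + 2 * r * u + a * log u) * R u := by
  have hint : IntegrableOn (fun u => exp (-u ^ 2 + 2 * r * u + a * log u) * R u) (Ioi 0) := by
    refine Integrable.mono' ((integrable_gaussian_sub u₀).const_mul
      (K * exp (-u₀ ^ 2 + 2 * r * u₀ + a * log u₀))).integrableOn ?_ ?_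
    · exact (StronglyMeasurable.mul
        (Measurable.stronglyMeasurable (by fun_prop)) hRm).aestronglyMeasurable
    · filter_upwards [ae_restrict_mem measurableSet_Ioi] with u hu
      rw [norm_of_nonneg (mul_nonneg (exp_pos _).le (hR₀ u))]
      exact exp_mul_le_gaussian hu₀ ha hc hK hR hu
  have hsub : Ioc u₀ (u₀ + 1) ⊆ Ioi 0 := fun u hu => hu₀.trans hu.1
  calc c * exp (-3) * exp (-u₀ ^ 2 + 2 * r * u₀ + a * log u₀)
      = ∫ u in Ioc u₀ (u₀ + 1), c * exp (-3) * exp (-u₀ ^ 2 + 2 * r * u₀ + a * log u₀) := by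
        simp
    _ ≤ ∫ u in Ioc u₀ (u₀ + 1), exp (-u ^ 2 + 2 * r * u + a * log u) * R u := by
        refine setIntegral_mono_on (integrableOn_const (by simp)) (hint.mono_set hsub) measurableSet_Ioc ?_
        intro u hu
        have h1 := le_exponent_of_critical hu₀ ha hr hc hu.1.le
        have h2 := hRc u hu.1.le
        have h3 : (u - u₀) ^ 2 ≤ 1 := by nlinarith [hu.1, hu.2]
        rw [mul_assoc c, ← exp_add, mul_comm c]
        exact mul_le_mul (exp_le_exp.mpr (by linarith)) h2 hc₀ (exp_pos _).le
    _ ≤ _ := by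
        refine setIntegral_mono_set hint ?_ (.of_forall hsub)
        exact .of_forall fun u => mul_nonneg (exp_pos _).le (hR₀ u)

end Laplace

lemma exists_PhiSharp_bounds : ∃ c K : ℝ, 0 < c ∧ 0 < K ∧ ∀ ν Q x u₀ : ℝ,
    -(1 / 3) ≤ ν → ν ≤ 0 → 1 ≤ Q → 1 ≤ x →
    u₀ = √x / 2 * (1 + √(1 + 4 * Q / x + 2 * (1 / 2 - ν) / x)) →
    let E := x ^ (-ν / 2 - 1 / 4) *
      exp (-x + (-u₀ ^ 2 + 2 * √x * u₀ + (2 * Q + (1 / 2 - ν)) * log u₀)) / Gamma (Q + 1)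
    Gamma (ν + 1) * c * E ≤ PhiSharp (ν - Q) (ν + 1) (-x) ∧
      PhiSharp (ν - Q) (ν + 1) (-x) ≤ Gamma (ν + 1) * K * E := by
  obtain ⟨K, hK, hRK⟩ := exists_besselRatio_le
  refine ⟨√2 * (exp (-1 / 2) / (2 * π) * exp (-3)), √2 * (K * √π), by positivity, by positivity,
    fun ν Q x u₀ h₀ h₁ hQ hx hu => ?_⟩
  intro E
  have hx0 : 0 < x := by linarith
  have hsx : 1 ≤ √x := one_le_sqrt.mpr hx
  have ha : 0 < 2 * Q + (1 / 2 - ν) := by linarith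
  set w := √(1 + 4 * Q / x + 2 * (1 / 2 - ν) / x) with hw
  have hν : 0 ≤ 1 / 2 - ν := by linarith
  have hw2 : x * w ^ 2 = x + 2 * (2 * Q + (1 / 2 - ν)) := by
    rw [hw, sq_sqrt (by positivity)]
    field_simp
    ring
  have hw1 : 1 ≤ w := by
    rw [hw, one_le_sqrt, add_assoc]
    exact le_add_of_nonneg_right (by positivity)
  have hux : √x ≤ u₀ := by rw [hu]; nlinarith
  have hu₀ : 0 < u₀ := by linarith
  have hc : 2 * √x * u₀ = 2 * u₀ ^ 2 - (2 * Q + (1 / 2 - ν)) := by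
    rw [hu]
    linear_combination (-(w ^ 2 - 1) / 2) * sq_sqrt hx0.le - hw2 / 2
  have hR₀ : ∀ u, 0 ≤ besselRatio ν (2 * √x * u) := fun u => besselRatio_nonneg h₀ h₁ _
  have hR : ∀ u, 0 < u → besselRatio ν (2 * √x * u) ≤ K :=
    fun u hu => hRK ν _ h₀ (by positivity)
  have hRc : ∀ u, u₀ ≤ u → exp (-1 / 2) / (2 * π) ≤ besselRatio ν (2 * √x * u) :=
    fun u hu => le_besselRatio h₀ h₁ (by nlinarith)
  have hRm : StronglyMeasurable fun u => besselRatio ν (2 * √x * u) :=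
    (stronglyMeasurable_besselRatio ν).comp_measurable (by fun_prop)
  have hlow := laplace_lower_bound hu₀ ha (sqrt_nonneg x) hc hRm hK.le hR₀ hR
    (by positivity) hRc
  have hup := laplace_upper_bound hu₀ ha hc hK.le hR₀ hR
  have hΓ : 0 < Gamma (ν + 1) := Gamma_pos_of_pos (by linarith)
  have hΓQ : 0 < Gamma (Q + 1) := Gamma_pos_of_pos (by linarith)
  have hE : E = x ^ (-ν / 2 - 1 / 4) * exp (-x) / Gamma (Q + 1) *
      exp (-u₀ ^ 2 + 2 * √x * u₀ + (2 * Q + (1 / 2 - ν)) * log u₀) := by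
    simp only [E]
    rw [exp_add (-x)]
    ring
  have hA : 0 ≤ √2 * Gamma (ν + 1) * (x ^ (-ν / 2 - 1 / 4) * exp (-x) / Gamma (Q + 1)) := by
    positivity
  rw [PhiSharp_eq hx0, hE]
  constructor
  · refine le_of_eq_of_le ?_ (mul_le_mul_of_nonneg_left hlow hA)
    ring
  · refine (mul_le_mul_of_nonneg_left hup hA).trans_eq ?_
    ring

/-- For an integer `n ≥ 3`, `α = 1 − 1/n`, `γₙ = 1/2 + 1/n`, there is a constant `C > 1`
depending only on `n` such that for every `β ≤ 0` with `Q := α − β − 1 ≥ 1` and every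
`y ≤ −1`: `C⁻¹ · Q^{−1/4} · (−y)^{(2−n)/(4n)} · e^{y+G(u₀)}/Γ(Q+1) ≤ Φ♯(β, α, y)
  ≤ C · (−y)^{(2−n)/(4n)} · e^{y+G(u₀)}/Γ(Q+1)`,
where `G(u) = −u² + 2(−y)^{1/2}u + (2Q+γₙ)·log u` and
`u₀ = ((−y)^{1/2}/2)·(1 + √(1 + 4Q/(−y) + 2γₙ/(−y)))`. -/
theorem PhiSharp_bounds_large_Q (n : ℕ) (hn : 3 ≤ n) :
    ∃ C : ℝ, 1 < C ∧ ∀ β : ℝ, β ≤ 0 →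
      ∀ Q : ℝ, Q = (1 - 1 / (n : ℝ)) - β - 1 → 1 ≤ Q →
      ∀ y : ℝ, y ≤ -1 →
      ∀ u₀ : ℝ, u₀ = (Real.sqrt (-y) / 2) *
          (1 + Real.sqrt (1 + 4 * Q / (-y) + 2 * (1 / 2 + 1 / (n : ℝ)) / (-y))) →
        C⁻¹ * Q ^ (-(1 : ℝ) / 4) *
            ((-y) ^ ((2 - (n : ℝ)) / (4 * (n : ℝ))) *
              Real.exp (y + (-u₀ ^ 2 + 2 * Real.sqrt (-y) * u₀ +
                (2 * Q + (1 / 2 + 1 / (n : ℝ))) * Real.log u₀)) / Real.Gamma (Q + 1))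
          ≤ PhiSharp β (1 - 1 / (n : ℝ)) y ∧
        PhiSharp β (1 - 1 / (n : ℝ)) y
          ≤ C * ((-y) ^ ((2 - (n : ℝ)) / (4 * (n : ℝ))) *
              Real.exp (y + (-u₀ ^ 2 + 2 * Real.sqrt (-y) * u₀ +
                (2 * Q + (1 / 2 + 1 / (n : ℝ))) * Real.log u₀)) / Real.Gamma (Q + 1)) := by
  obtain ⟨c, K, hc, hK, h⟩ := exists_PhiSharp_bounds
  have hn' : (3 : ℝ) ≤ n := by exact_mod_cast hn
  have hn0 : (0 : ℝ) < n := by linarith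
  have hninv : 1 / (n : ℝ) ≤ 1 / 3 := one_div_le_one_div_of_le (by norm_num) hn'
  have hΓ : 0 < Gamma (-(1 / (n : ℝ)) + 1) := Gamma_pos_of_pos (by linarith)
  set g := Gamma (-(1 / (n : ℝ)) + 1)
  refine ⟨1 + (g * c)⁻¹ + g * K, by linarith [show 0 < (g * c)⁻¹ + g * K by positivity], ?_⟩
  intro β _ Q hQ hQ1 y hy u₀ hu₀
  have hβ : β = -(1 / (n : ℝ)) - Q := by linarith
  obtain ⟨hlow, hup⟩ := h (-(1 / (n : ℝ))) Q (-y) u₀ (by linarith)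
    (by have : 0 < 1 / (n : ℝ) := by positivity
        linarith) hQ1 (by linarith)
    (by rw [hu₀, sub_neg_eq_add])
  have hα : 1 - 1 / (n : ℝ) = -(1 / (n : ℝ)) + 1 := by ring
  have hexp : (2 - (n : ℝ)) / (4 * n) = -(-(1 / (n : ℝ))) / 2 - 1 / 4 := by field_simp; ring
  rw [hα, hβ, hexp]
  simp only [neg_neg, sub_neg_eq_add] at hlow hup ⊢
  set E := (-y) ^ (1 / (n : ℝ) / 2 - 1 / 4) * exp (y + (-u₀ ^ 2 + 2 * √(-y) * u₀ +
    (2 * Q + (1 / 2 + 1 / (n : ℝ))) * log u₀)) / Gamma (Q + 1)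
  have hE : 0 ≤ E := by
    have := Gamma_pos_of_pos (show 0 < Q + 1 by linarith)
    have : 0 ≤ -y := by linarith
    positivity
  constructor
  · refine le_trans (mul_le_mul_of_nonneg_right ?_ hE) hlow
    have hQp : Q ^ (-(1 : ℝ) / 4) ≤ 1 := rpow_le_one_of_one_le_of_nonpos hQ1 (by norm_num)
    have hinv : (1 + (g * c)⁻¹ + g * K)⁻¹ ≤ g * c := by
      apply inv_le_of_inv_le₀ (by positivity)
      have : 0 < g * K := by positivity
      linarith
    exact (mul_le_of_le_one_right (by positivity) hQp).trans hinv
  · refine hup.trans (mul_le_mul_of_nonneg_right ?_ hE)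
    have : 0 < (g * c)⁻¹ := by positivity
    linarith
end

section
/- Let n ≥ 3 be an integer, γ_n = 1/2 + 1/n, and Q ≥ 1. There exists a constant C > 1, depending only on n, such that for every positive integer j and every z ≥ 1, setting y = −j·z^{n}: e^{F(t₀) + G(u₀)} ≤ C · j^{(n+2)/(4n)} · z^{(n+2)/4} · e^{j·z^{n}} · e^{−Q} · Q^{Q + (n+2)/(4n)}, where F(t) = y·t + Q·log(t/(t+1)), t₀ = (1/2)·(−1 + √(1 + 4Q/(−y))), G(u) = −u² + 2·(−y)^{1/2}·u + (2Q + γ_n)·log u, and u₀ = ((−y)^{1/2}/2)·(1 + √(1 + 4Q/(−y) + 2γ_n/(−y))). -/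
open Real in
/-- The logarithmic form of the bound: `t` is the critical point of
`t ↦ -s² t + Q log (t / (t + 1))`, and `u` is at most twice the critical point `s (t + 1)` of
`u ↦ -u² + 2 s u + 2 Q log u`. -/
lemma phase_sum_le {Q g s t u : ℝ} (hQ : 1 ≤ Q) (hg : 0 ≤ g) (hs : 0 < s) (ht : 0 < t)
    (htQ : s ^ 2 * (t * (t + 1)) = Q) (htle : (t + 1) ^ 2 ≤ 4 * Q) (hu : 0 < u)
    (hule : u ≤ 2 * (s * (t + 1))) :
    (-(s ^ 2) * t + Q * log (t / (t + 1))) + (-u ^ 2 + 2 * s * u + (2 * Q + g) * log u) ≤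
      2 * g + g / 2 * log (s ^ 2) + s ^ 2 + -Q + (Q + g / 2) * log Q := by
  have hT : 0 < t + 1 := by linarith
  have hu₁ : 0 < s * (t + 1) := mul_pos hs hT
  obtain ⟨x, hx⟩ : ∃ x, u = s * (t + 1) * (1 + x) :=
    ⟨u / (s * (t + 1)) - 1, by field_simp; ring⟩
  have hx1 : 0 < 1 + x := by
    rw [hx] at hu
    exact pos_of_mul_pos_right hu hu₁.le
  have hx2 : x ≤ 1 := by
    rw [hx, mul_comm 2] at hule
    linarith [le_of_mul_le_mul_left hule hu₁]
  have hlogu : log u ≤ log s + log (t + 1) + x := by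
    rw [hx, log_mul hu₁.ne' hx1.ne', log_mul hs.ne' hT.ne']
    linarith [log_le_sub_one_of_pos hx1]
  have hlogQ : log Q = 2 * log s + (log t + log (t + 1)) := by
    rw [← htQ, log_mul (by positivity) (by positivity), log_mul ht.ne' hT.ne', log_pow]
    norm_num
  have hlogT : 2 * log (t + 1) ≤ 2 + log Q := by
    have h := log_le_log (by positivity) htle
    rw [log_mul (by norm_num) (by positivity), log_pow,
      show (4 : ℝ) = 2 ^ 2 by norm_num, log_pow] at h
    push_cast at h
    linarith [log_two_lt_d9]
  have hlogs : log (s ^ 2) = 2 * log s := by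
    rw [log_pow]; norm_num
  have hquad : -u ^ 2 + 2 * s * u =
      s ^ 2 * (1 - t ^ 2) - 2 * x * Q - (s * (t + 1) * x) ^ 2 := by
    rw [hx, ← htQ]; ring
  have h₁ := mul_le_mul_of_nonneg_left hlogu (by linarith : 0 ≤ 2 * Q + g)
  have h₂ := mul_le_mul_of_nonneg_left hlogT hg
  have h₃ := mul_le_mul_of_nonneg_left hx2 hg
  rw [log_div ht.ne' hT.ne', hquad, hlogs]
  have h₄ : Q * log Q = Q * (2 * log s + (log t + log (t + 1))) := by rw [← hlogQ]
  nlinarith [sq_nonneg (s * (t + 1) * x)]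


/-- For an integer `n ≥ 3` with `γₙ = 1/2 + 1/n`, there is a constant `C > 1` depending only
on `n` such that for every `Q ≥ 1`, every positive integer `j` and every `z ≥ 1`, setting
`y = −j·z^n`: `e^{F(t₀)+G(u₀)} ≤ C · j^{(n+2)/(4n)} · z^{(n+2)/4} · e^{j·z^n} · e^{−Q} ·
Q^{Q+(n+2)/(4n)}`, where `F(t) = y·t + Q·log(t/(t+1))`,
`t₀ = (1/2)(−1 + √(1 + 4Q/(−y)))`, `G(u) = −u² + 2(−y)^{1/2}u + (2Q+γₙ)·log u`, and
`u₀ = ((−y)^{1/2}/2)(1 + √(1 + 4Q/(−y) + 2γₙ/(−y)))`. -/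
theorem exp_F_G_bound (n : ℕ) (hn : 3 ≤ n) :
    ∃ C : ℝ, 1 < C ∧ ∀ Q : ℝ, 1 ≤ Q → ∀ j : ℕ, 0 < j → ∀ z : ℝ, 1 ≤ z →
      ∀ y : ℝ, y = -(j : ℝ) * z ^ (n : ℝ) →
      ∀ t₀ : ℝ, t₀ = (1 / 2) * (-1 + Real.sqrt (1 + 4 * Q / (-y))) →
      ∀ u₀ : ℝ, u₀ = (Real.sqrt (-y) / 2) *
          (1 + Real.sqrt (1 + 4 * Q / (-y) + 2 * (1 / 2 + 1 / (n : ℝ)) / (-y))) →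
        Real.exp ((y * t₀ + Q * Real.log (t₀ / (t₀ + 1))) +
            (-u₀ ^ 2 + 2 * Real.sqrt (-y) * u₀ +
              (2 * Q + (1 / 2 + 1 / (n : ℝ))) * Real.log u₀))
          ≤ C * (j : ℝ) ^ (((n : ℝ) + 2) / (4 * (n : ℝ))) * z ^ (((n : ℝ) + 2) / 4) *
              Real.exp ((j : ℝ) * z ^ (n : ℝ)) * Real.exp (-Q) *
              Q ^ (Q + ((n : ℝ) + 2) / (4 * (n : ℝ))) := by
  have hn0 : (0 : ℝ) < n := by exact_mod_cast (by omega : 0 < n)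
  have hg0 : 0 ≤ 1 / 2 + 1 / (n : ℝ) := by positivity
  have hg1 : 1 / 2 + 1 / (n : ℝ) ≤ 1 := by
    have h : 1 / (n : ℝ) ≤ 1 / 3 :=
      one_div_le_one_div_of_le (by norm_num) (by exact_mod_cast hn)
    linarith
  have hexp : ((n : ℝ) + 2) / (4 * n) = (1 / 2 + 1 / (n : ℝ)) / 2 := by field_simp; norm_num
  have hexpz : ((n : ℝ) + 2) / 4 = n * ((1 / 2 + 1 / (n : ℝ)) / 2) := by field_simp; norm_num
  refine ⟨Real.exp (2 * (1 / 2 + 1 / (n : ℝ))), Real.one_lt_exp_iff.mpr (by positivity), ?_⟩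
  intro Q hQ j hj z hz y hy t₀ ht₀ u₀ hu₀
  rw [hexp, hexpz]
  generalize 1 / 2 + 1 / (n : ℝ) = g at *
  have hj1 : (1 : ℝ) ≤ j := by exact_mod_cast hj
  have hz0 : 0 < z := by linarith
  have hY : 1 ≤ (j : ℝ) * z ^ (n : ℝ) :=
    one_le_mul_of_one_le_of_one_le hj1 (Real.one_le_rpow hz hn0.le)
  have hprod : (j : ℝ) ^ (g / 2) * z ^ (n * (g / 2)) = ((j : ℝ) * z ^ (n : ℝ)) ^ (g / 2) := by
    rw [Real.mul_rpow (by positivity) (by positivity), ← Real.rpow_mul hz0.le]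
  rw [mul_assoc (Real.exp (2 * g)), hprod]
  rw [neg_mul] at hy
  generalize (j : ℝ) * z ^ (n : ℝ) = Y at *
  subst hy
  rw [neg_neg] at *
  have hY0 : 0 < Y := by linarith
  obtain ⟨s, hs, rfl⟩ : ∃ s, 0 < s ∧ Y = s ^ 2 :=
    ⟨√Y, Real.sqrt_pos.mpr hY0, (Real.sq_sqrt hY0.le).symm⟩
  rw [Real.sqrt_sq hs.le] at *
  have hQY : 0 < 4 * Q / s ^ 2 := by positivity
  have hr2 : √(1 + 4 * Q / s ^ 2) ^ 2 = 1 + 4 * Q / s ^ 2 := Real.sq_sqrt (by positivity)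
  have hr1 : 1 < √(1 + 4 * Q / s ^ 2) := Real.lt_sqrt_of_sq_lt (by linarith)
  have hw : √(1 + 4 * Q / s ^ 2 + 2 * g / s ^ 2) ≤ 2 * √(1 + 4 * Q / s ^ 2) := by
    refine Real.sqrt_le_iff.mpr ⟨by positivity, ?_⟩
    rw [mul_pow, hr2]
    have : 2 * g / s ^ 2 ≤ 4 * Q / s ^ 2 := by gcongr ?_ / _; linarith
    linarith
  have hw0 := Real.sqrt_nonneg (1 + 4 * Q / s ^ 2 + 2 * g / s ^ 2)
  generalize √(1 + 4 * Q / s ^ 2 + 2 * g / s ^ 2) = w at *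
  generalize √(1 + 4 * Q / s ^ 2) = r at *
  have hr2' : s ^ 2 * r ^ 2 = s ^ 2 + 4 * Q := by rw [hr2]; field_simp
  have hdiv : 4 * Q / s ^ 2 ≤ 4 * Q := div_le_self (by linarith) hY
  have key := phase_sum_le (Q := Q) (g := g) (s := s) (t := t₀) (u := u₀) hQ hg0 hs
    (by rw [ht₀]; linarith) (by rw [ht₀]; linarith)
    (by rw [ht₀]; nlinarith [sq_nonneg (r - 1)]) (by rw [hu₀]; positivity)
    (by rw [hu₀, ht₀]; nlinarith)
  rw [Real.rpow_def_of_pos hY0, Real.rpow_def_of_pos (by linarith : 0 < Q)]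
  simp only [← Real.exp_add]
  rw [Real.exp_le_exp]
  linarith
end
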